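/- arXiv:2505.22760 — 3 statements merged into one kernel-verified Lean document; each statement's English description precedes it below -/
import Mathlib

section
/- Let S and A be Polish spaces, P : S × A → P(S) a transition kernel, c : S × A → R bounded and measurable, δ ∈ [0,1), τ > 0, and η a finite positive measure on A. Let f : R^d × S × A → R be bounded, measurable, and differentiable in θ with uniformly bounded gradient (f ∈ 𝔠^1). For ν ∈ P_1(R^d), define the softmax policy π_ν(da|s) ∝ exp(∫ f(θ,s,a) ν(dθ)) η(da), and let V_τ^{π_ν}(γ) be the τ-entropy-regularized discounted expected cumulative cost of the policy π_ν started from initial distribution γ ∈ P(S). Then for every γ ∈ P(S), the function F(ν) := V_τ^{π_ν}(γ) satisfies Assumption (A1): it has a bounded flat derivative with |δF/δν(ν,θ)| ≤ C_F, where C_F := (2/(1−δ)²)(|c|_∞ + τ(2|f|_{𝔠^0} + |log η(A)|))|f|_{𝔠^0}, and |δF/δν(ν',θ') − δF/δν(ν,θ)| ≤ L_F(|θ'−θ| + W_1(ν',ν)), where L_F := |f|_{𝔠^1}((1/(1−δ)²)(|c|_∞ + τ(2|f|_{𝔠^0} + |log η(A)|)) · max{2, (5/(1−δ))|f|_{𝔠^0}}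 + 4τ|f|_{𝔠^0}). -/
open MeasureTheory Filter

noncomputable section

attribute [local instance] Classical.propDecidable

/-- Euclidean space `ℝ^d`. -/
abbrev Ed (d : ℕ) := EuclideanSpace ℝ (Fin d)

/-- `P₁(ℝ^d)`: Borel probability measures on `ℝ^d` with finite first moment. -/
def IsP1 {d : ℕ} (ν : Measure (Ed d)) : Prop :=
  IsProbabilityMeasure ν ∧ Integrable (fun x => ‖x‖) ν

/-- The `L¹`-Wasserstein distance, defined via Kantorovich–Rubinstein duality as the
supremum of `∫ f dν - ∫ f dν'` over `1`-Lipschitz functions `f`. -/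
def W1 {d : ℕ} (ν ν' : Measure (Ed d)) : ℝ :=
  ⨆ f : {f : Ed d → ℝ // LipschitzWith 1 f}, (∫ x, f.1 x ∂ν - ∫ x, f.1 x ∂ν')

/-- The Wasserstein distance on the product space:
`W̃₁((ν,μ),(ν',μ')) = W₁(ν,ν') + W₁(μ,μ')`. -/
def W1pair {d : ℕ} (p q : Measure (Ed d) × Measure (Ed d)) : ℝ :=
  W1 p.1 q.1 + W1 p.2 q.2

/-- Total variation distance between two (probability) measures. -/
def TVdist {d : ℕ} (ν ν' : Measure (Ed d)) : ℝ :=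
  ⨆ A : {A : Set (Ed d) // MeasurableSet A}, |(ν A.1).toReal - (ν' A.1).toReal|

/-- The convex combination `(1-ε)·ν + ε·ν' = ν + ε(ν' - ν)`. -/
def mix {d : ℕ} (ν ν' : Measure (Ed d)) (ε : ℝ) : Measure (Ed d) :=
  ENNReal.ofReal (1 - ε) • ν + ENNReal.ofReal ε • ν'

/-- `DF` is the flat derivative of `F : P₁(ℝ^d) → ℝ`: it has at most linear growth,
satisfies the first-variation identity, and is normalized by `∫ DF(ν,x) ν(dx) = 0`. -/
structure IsFlatDeriv {d : ℕ} (F : Measure (Ed d) → ℝ)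
    (DF : Measure (Ed d) → Ed d → ℝ) : Prop where
  growth : ∃ κ : ℝ, 0 < κ ∧ ∀ ν x, IsP1 ν → |DF ν x| ≤ κ * (1 + ‖x‖)
  firstVariation : ∀ ν ν', IsP1 ν → IsP1 ν' →
    Tendsto (fun ε : ℝ => (F (mix ν ν' ε) - F ν) / ε) (nhdsWithin 0 (Set.Ioi 0))
      (nhds (∫ x, DF ν x ∂ν' - ∫ x, DF ν x ∂ν))
  normalized : ∀ ν, IsP1 ν → ∫ x, DF ν x ∂ν = 0

/-- Assumption (A1): `F ∈ C¹` with flat derivative `DF` bounded by `C_F` and Lipschitz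
with constant `L_F` against `‖x'-x‖ + W₁(ν',ν)`. -/
structure AssumptionA1 {d : ℕ} (F : Measure (Ed d) → ℝ)
    (DF : Measure (Ed d) → Ed d → ℝ) (CF LF : ℝ) : Prop where
  CF_pos : 0 < CF
  LF_pos : 0 < LF
  flat : IsFlatDeriv F DF
  bounded : ∀ ν x, IsP1 ν → |DF ν x| ≤ CF
  lipschitz : ∀ ν ν' x x', IsP1 ν → IsP1 ν' →
    |DF ν' x' - DF ν x| ≤ LF * (‖x' - x‖ + W1 ν' ν)

/-- The reference measure `ξ(dx) = e^{-U(x)} dx`. -/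
def xiMeasure {d : ℕ} (U : Ed d → ℝ) : Measure (Ed d) :=
  volume.withDensity (fun x => ENNReal.ofReal (Real.exp (-U x)))

/-- Assumption (A2): `ξ = e^{-U} dx` is a probability measure, `U` is measurable,
essentially bounded below, and has at least linear growth at infinity. -/
structure AssumptionA2 {d : ℕ} (U : Ed d → ℝ) : Prop where
  measurable : Measurable U
  isProb : IsProbabilityMeasure (xiMeasure U)
  essBddBelow : ∃ c : ℝ, ∀ᵐ x ∂(volume : Measure (Ed d)), c ≤ U x
  linGrowth : 0 < Filter.liminf (fun x : Ed d => U x / ‖x‖)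
      (Filter.comap (fun x : Ed d => ‖x‖) Filter.atTop)

/-- Normalization constant `Z_σ(ν) = ∫ exp(-σ⁻¹ δF/δν(ν,x) - U(x)) dx`. -/
def Zsigma {d : ℕ} (DF : Measure (Ed d) → Ed d → ℝ) (U : Ed d → ℝ) (σ : ℝ)
    (ν : Measure (Ed d)) : ℝ :=
  ∫ x, Real.exp (-(σ⁻¹) * DF ν x - U x)

/-- Lebesgue density of the Best Response measure `Ψ_σ[ν]`. -/
def PsiDensity {d : ℕ} (DF : Measure (Ed d) → Ed d → ℝ) (U : Ed d → ℝ) (σ : ℝ)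
    (ν : Measure (Ed d)) (x : Ed d) : ℝ :=
  (Zsigma DF U σ ν)⁻¹ * Real.exp (-(σ⁻¹) * DF ν x - U x)

/-- The Best Response operator `Ψ_σ[ν](dx) = Z_σ(ν)⁻¹ exp(-σ⁻¹ δF/δν(ν,x)) ξ(dx)`. -/
def Psi {d : ℕ} (DF : Measure (Ed d) → Ed d → ℝ) (U : Ed d → ℝ) (σ : ℝ)
    (ν : Measure (Ed d)) : Measure (Ed d) :=
  volume.withDensity (fun x => ENNReal.ofReal (PsiDensity DF U σ ν x))

/-- Relative entropy (KL divergence) `KL(ν|ξ) ∈ [0,∞]`, equal to `∫ log(dν/dξ) dν`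
when `ν ≪ ξ` with integrable log-density, and `+∞` otherwise. -/
def KLdiv {d : ℕ} (ν ξ : Measure (Ed d)) : EReal :=
  if ν ≪ ξ ∧ Integrable (fun x => Real.log ((ν.rnDeriv ξ x).toReal)) ν
  then ((∫ x, Real.log ((ν.rnDeriv ξ x).toReal) ∂ν : ℝ) : EReal)
  else ⊤

/-- The entropy-regularized functional `F^σ(ν) = F(ν) + σ KL(ν|ξ)`. -/
def Fsigma {d : ℕ} (F : Measure (Ed d) → ℝ) (U : Ed d → ℝ) (σ : ℝ)
    (ν : Measure (Ed d)) : EReal :=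
  (F ν : EReal) + (σ : EReal) * KLdiv ν (xiMeasure U)

/-- `(ν_t)_{t ≥ 0}` is a solution of the Best Response flow
`dν_t = α(Ψ_σ[ν_t] - ν_t) dt`, in mild (Duhamel) form:
`ν_t = e^{-αt} ν_0 + ∫_0^t α e^{-α(t-s)} Ψ_σ[ν_s] ds`, with `ν_t ∈ P₁` for all `t ≥ 0`. -/
def IsBRFlow {d : ℕ} (DF : Measure (Ed d) → Ed d → ℝ) (U : Ed d → ℝ)
    (σ α : ℝ) (ν : ℝ → Measure (Ed d)) : Prop :=
  (∀ t : ℝ, 0 ≤ t → IsP1 (ν t)) ∧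
  ∀ t : ℝ, 0 ≤ t → ∀ A : Set (Ed d), MeasurableSet A →
    ((ν t) A).toReal = Real.exp (-(α * t)) * ((ν 0) A).toReal +
      ∫ s in Set.Ioc (0:ℝ) t,
        α * Real.exp (-(α * (t - s))) * ((Psi DF U σ (ν s)) A).toReal

/-! ### Two-player (min-max) setting -/

/-- Assumption (B1): `F : P₁ × P₁ → ℝ` has flat derivatives `DFν`, `DFμ` in each argument,
bounded by `C_F`, `C̄_F` and Lipschitz with constants `L_F`, `L̄_F` against
`‖x'-x‖ + W̃₁((ν,μ),(ν',μ'))` (resp. `‖y'-y‖ + W̃₁((ν,μ),(ν',μ'))`). -/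
structure AssumptionB1 {d : ℕ} (F : Measure (Ed d) → Measure (Ed d) → ℝ)
    (DFnu DFmu : Measure (Ed d) → Measure (Ed d) → Ed d → ℝ)
    (CF CbF LF LbF : ℝ) : Prop where
  CF_pos : 0 < CF
  CbF_pos : 0 < CbF
  LF_pos : 0 < LF
  LbF_pos : 0 < LbF
  flat_fst : ∀ μ, IsP1 μ → IsFlatDeriv (fun ν => F ν μ) (fun ν => DFnu ν μ)
  flat_snd : ∀ ν, IsP1 ν → IsFlatDeriv (fun μ => F ν μ) (fun μ => DFmu ν μ)
  bounded_fst : ∀ ν μ x, IsP1 ν → IsP1 μ → |DFnu ν μ x| ≤ CF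
  bounded_snd : ∀ ν μ y, IsP1 ν → IsP1 μ → |DFmu ν μ y| ≤ CbF
  lip_fst : ∀ ν μ ν' μ' x x', IsP1 ν → IsP1 μ → IsP1 ν' → IsP1 μ' →
    |DFnu ν' μ' x' - DFnu ν μ x| ≤ LF * (‖x' - x‖ + W1pair (ν, μ) (ν', μ'))
  lip_snd : ∀ ν μ ν' μ' y y', IsP1 ν → IsP1 μ → IsP1 ν' → IsP1 μ' →
    |DFmu ν' μ' y' - DFmu ν μ y| ≤ LbF * (‖y' - y‖ + W1pair (ν, μ) (ν', μ'))

/-- Normalization constant for the first player's Best Response operator. -/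
def Zpsi2 {d : ℕ} (DFnu : Measure (Ed d) → Measure (Ed d) → Ed d → ℝ) (U : Ed d → ℝ)
    (σ : ℝ) (ν μ : Measure (Ed d)) : ℝ :=
  ∫ x, Real.exp (-(σ⁻¹) * DFnu ν μ x - U x)

/-- Lebesgue density of the first player's Best Response measure `Ψ_{σ_ν}[ν,μ]`. -/
def Psi2Density {d : ℕ} (DFnu : Measure (Ed d) → Measure (Ed d) → Ed d → ℝ)
    (U : Ed d → ℝ) (σ : ℝ) (ν μ : Measure (Ed d)) (x : Ed d) : ℝ :=
  (Zpsi2 DFnu U σ ν μ)⁻¹ * Real.exp (-(σ⁻¹) * DFnu ν μ x - U x)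

/-- First player's Best Response operator
`Ψ_{σ_ν}[ν,μ](dx) ∝ exp(-σ_ν⁻¹ δF/δν(ν,μ,x)) ξ(dx)`. -/
def Psi2 {d : ℕ} (DFnu : Measure (Ed d) → Measure (Ed d) → Ed d → ℝ) (U : Ed d → ℝ)
    (σ : ℝ) (ν μ : Measure (Ed d)) : Measure (Ed d) :=
  volume.withDensity (fun x => ENNReal.ofReal (Psi2Density DFnu U σ ν μ x))

/-- Normalization constant for the second player's Best Response operator. -/
def Zphi2 {d : ℕ} (DFmu : Measure (Ed d) → Measure (Ed d) → Ed d → ℝ) (V : Ed d → ℝ)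
    (σ : ℝ) (ν μ : Measure (Ed d)) : ℝ :=
  ∫ y, Real.exp (σ⁻¹ * DFmu ν μ y - V y)

/-- Lebesgue density of the second player's Best Response measure `Φ_{σ_μ}[ν,μ]`. -/
def Phi2Density {d : ℕ} (DFmu : Measure (Ed d) → Measure (Ed d) → Ed d → ℝ)
    (V : Ed d → ℝ) (σ : ℝ) (ν μ : Measure (Ed d)) (y : Ed d) : ℝ :=
  (Zphi2 DFmu V σ ν μ)⁻¹ * Real.exp (σ⁻¹ * DFmu ν μ y - V y)

/-- Second player's Best Response operator
`Φ_{σ_μ}[ν,μ](dy) ∝ exp(σ_μ⁻¹ δF/δμ(ν,μ,y)) ρ(dy)`. -/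
def Phi2 {d : ℕ} (DFmu : Measure (Ed d) → Measure (Ed d) → Ed d → ℝ) (V : Ed d → ℝ)
    (σ : ℝ) (ν μ : Measure (Ed d)) : Measure (Ed d) :=
  volume.withDensity (fun y => ENNReal.ofReal (Phi2Density DFmu V σ ν μ y))

/-- The regularized payoff `F^{σ_ν,σ_μ}(ν,μ) = F(ν,μ) + σ_ν KL(ν|ξ) - σ_μ KL(μ|ρ)`,
where `ξ = e^{-U} dx` and `ρ = e^{-V} dy`. -/
def FsigmaGame {d : ℕ} (F : Measure (Ed d) → Measure (Ed d) → ℝ) (U V : Ed d → ℝ)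
    (σν σμ : ℝ) (ν μ : Measure (Ed d)) : EReal :=
  (F ν μ : EReal) + (σν : EReal) * KLdiv ν (xiMeasure U)
    - (σμ : EReal) * KLdiv μ (xiMeasure V)

/-- `(ν*, μ*)` is a mixed Nash equilibrium of `F^{σ_ν,σ_μ}`:
`ν* ∈ argmin_ν F^{σ_ν,σ_μ}(ν,μ*)` and `μ* ∈ argmax_μ F^{σ_ν,σ_μ}(ν*,μ)` over `P₁(ℝ^d)`. -/
def IsMNE {d : ℕ} (F : Measure (Ed d) → Measure (Ed d) → ℝ) (U V : Ed d → ℝ)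
    (σν σμ : ℝ) (νs μs : Measure (Ed d)) : Prop :=
  IsP1 νs ∧ IsP1 μs ∧
  (∀ ν, IsP1 ν → FsigmaGame F U V σν σμ νs μs ≤ FsigmaGame F U V σν σμ ν μs) ∧
  (∀ μ, IsP1 μ → FsigmaGame F U V σν σμ νs μ ≤ FsigmaGame F U V σν σμ νs μs)

/-- `(ν_t, μ_t)_{t≥0}` solves the two-player Best Response flow
`dν_t = α_ν(Ψ_{σ_ν}[ν_t,μ_t] - ν_t)dt`, `dμ_t = α_μ(Φ_{σ_μ}[ν_t,μ_t] - μ_t)dt`,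
in mild (Duhamel) form, with `(ν_t, μ_t) ∈ P₁ × P₁` for all `t ≥ 0`. -/
def IsBRFlow2 {d : ℕ} (DFnu DFmu : Measure (Ed d) → Measure (Ed d) → Ed d → ℝ)
    (U V : Ed d → ℝ) (σν σμ αν αμ : ℝ) (ν μ : ℝ → Measure (Ed d)) : Prop :=
  (∀ t : ℝ, 0 ≤ t → IsP1 (ν t) ∧ IsP1 (μ t)) ∧
  (∀ t : ℝ, 0 ≤ t → ∀ A : Set (Ed d), MeasurableSet A →
    ((ν t) A).toReal = Real.exp (-(αν * t)) * ((ν 0) A).toReal +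
      ∫ s in Set.Ioc (0:ℝ) t,
        αν * Real.exp (-(αν * (t - s))) * ((Psi2 DFnu U σν (ν s) (μ s)) A).toReal) ∧
  (∀ t : ℝ, 0 ≤ t → ∀ A : Set (Ed d), MeasurableSet A →
    ((μ t) A).toReal = Real.exp (-(αμ * t)) * ((μ 0) A).toReal +
      ∫ s in Set.Ioc (0:ℝ) t,
        αμ * Real.exp (-(αμ * (t - s))) * ((Phi2 DFmu V σμ (ν s) (μ s)) A).toReal)

/-! ### Markov decision processes and Markov games -/

section MDP

variable {S A : Type*} [MeasurableSpace S] [MeasurableSpace A]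

/-- One-step state distribution update: `γ ↦ ∫∫ P(·|s,a) π(da|s) γ(ds)`. -/
def stepMeas (P : S → A → Measure S) (π : S → Measure A) (γ : Measure S) : Measure S :=
  γ.bind fun s => (π s).bind (P s)

/-- Expected one-step regularized cost at state `s`:
`∫_A (c(s,a) + τ log(dπ/dη)(a|s)) π(da|s)`. -/
def runCost (c : S → A → ℝ) (τ : ℝ) (η : Measure A) (π : S → Measure A) (s : S) : ℝ :=
  ∫ a, (c s a + τ * Real.log (((π s).rnDeriv η a).toReal)) ∂(π s)

/-- The `τ`-entropy-regularized discounted expected cumulative cost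
`V_τ^π(γ) = Σ_n δ^n E_{γ_n}[c(s_n,a_n) + τ log(dπ/dη)(a_n|s_n)]`,
where `γ_n` is the law of the state at time `n`. -/
def Vtau (P : S → A → Measure S) (c : S → A → ℝ) (δ τ : ℝ) (η : Measure A)
    (π : S → Measure A) (γ : Measure S) : ℝ :=
  ∑' n : ℕ, δ ^ n * ∫ s, runCost c τ η π s ∂((stepMeas P π)^[n] γ)

/-- The regularized state-action value function
`Q_τ^π(s,a) = c(s,a) + δ ∫ V_τ^π(s') P(ds'|s,a)`. -/
def Qtau (P : S → A → Measure S) (c : S → A → ℝ) (δ τ : ℝ) (η : Measure A)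
    (π : S → Measure A) (s : S) (a : A) : ℝ :=
  c s a + δ * ∫ s', Vtau P c δ τ η π (Measure.dirac s') ∂(P s a)

/-- The mean-field neural network `f_ν(s,a) = ∫ f(θ,s,a) ν(dθ)`. -/
def fnu {d : ℕ} (f : Ed d → S → A → ℝ) (ν : Measure (Ed d)) (s : S) (a : A) : ℝ :=
  ∫ θ, f θ s a ∂ν

/-- The softmax parametrized policy `π_ν(da|s) ∝ exp(f_ν(s,a)) η(da)`. -/
def softmaxPolicy {d : ℕ} (f : Ed d → S → A → ℝ) (η : Measure A) (ν : Measure (Ed d))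
    (s : S) : Measure A :=
  η.withDensity fun a => ENNReal.ofReal
    (Real.exp (fnu f ν s a) / ∫ a', Real.exp (fnu f ν s a') ∂η)

/-- The log-density `log (dπ_ν/dη)(a|s) = f_ν(s,a) - log ∫ exp(f_ν(s,a')) η(da')`
of the softmax policy. -/
def logSoftmaxDensity {d : ℕ} (f : Ed d → S → A → ℝ) (η : Measure A)
    (ν : Measure (Ed d)) (s : S) (a : A) : ℝ :=
  fnu f ν s a - Real.log (∫ a', Real.exp (fnu f ν s a') ∂η)

/-- One-step state distribution update for the two-player Markov game. -/
def stepMeas2 (P : S → A → A → Measure S) (π ζ : S → Measure A) (γ : Measure S) :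
    Measure S :=
  γ.bind fun s => (π s).bind fun a => (ζ s).bind fun b => P s a b

/-- Expected one-step `(τ₁,τ₂)`-regularized cost of the two-player game at state `s`. -/
def runCost2 (c : S → A → A → ℝ) (τ1 τ2 : ℝ) (η : Measure A) (π ζ : S → Measure A)
    (s : S) : ℝ :=
  ∫ a, (∫ b, (c s a b + τ1 * Real.log (((π s).rnDeriv η a).toReal)
      - τ2 * Real.log (((ζ s).rnDeriv η b).toReal)) ∂(ζ s)) ∂(π s)

/-- The `(τ₁,τ₂)`-entropy-regularized discounted total expected cost of the two-player
zero-sum Markov game. -/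
def Vtau2 (P : S → A → A → Measure S) (c : S → A → A → ℝ) (δ τ1 τ2 : ℝ) (η : Measure A)
    (π ζ : S → Measure A) (γ : Measure S) : ℝ :=
  ∑' n : ℕ, δ ^ n * ∫ s, runCost2 c τ1 τ2 η π ζ s ∂((stepMeas2 P π ζ)^[n] γ)

end MDP

/-! ### The Banach algebra of bounded measurable functions -/

/-- The subalgebra of measurable functions in the Banach algebra of bounded functions. -/
def boundedMeasurable (X : Type*) [MeasurableSpace X] :
    Subalgebra ℝ (lp (fun _ : X => ℝ) ⊤) where
  carrier := {φ | Measurable (φ : X → ℝ)}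
  mul_mem' := fun {a b} ha hb => by
    simp only [Set.mem_ofPred_eq, lp.infty_coeFn_mul] at *; exact ha.mul hb
  add_mem' := fun {a b} ha hb => by
    simp only [Set.mem_ofPred_eq, lp.coeFn_add] at *; exact ha.add hb
  algebraMap_mem' := fun r => by
    simp only [Set.mem_ofPred_eq]
    exact measurable_const (a := r)

/-- Bounded measurable real-valued functions on `X`, with the supremum norm. -/
def BM (X : Type*) [MeasurableSpace X] : Type _ := ↥(boundedMeasurable X)

namespace BM

variable {X Y : Type*} [MeasurableSpace X] [MeasurableSpace Y]

instance : NormedCommRing (BM X) := inferInstanceAs (NormedCommRing ↥(boundedMeasurable X))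

instance : NormedAlgebra ℝ (BM X) := inferInstanceAs (NormedAlgebra ℝ ↥(boundedMeasurable X))

instance : CoeFun (BM X) (fun _ => X → ℝ) := ⟨fun φ => φ.1.1⟩

@[ext] lemma ext {φ ψ : BM X} (h : ∀ x, φ x = ψ x) : φ = ψ :=
  Subtype.ext (lp.ext (funext h))

@[simp] lemma add_apply (φ ψ : BM X) (x : X) : (φ + ψ) x = φ x + ψ x := rfl
@[simp] lemma sub_apply (φ ψ : BM X) (x : X) : (φ - ψ) x = φ x - ψ x := rfl
@[simp] lemma neg_apply (φ : BM X) (x : X) : (-φ) x = -φ x := rfl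
@[simp] lemma mul_apply (φ ψ : BM X) (x : X) : (φ * ψ) x = φ x * ψ x := rfl
@[simp] lemma smul_apply (r : ℝ) (φ : BM X) (x : X) : (r • φ) x = r * φ x := rfl
@[simp] lemma one_apply (x : X) : (1 : BM X) x = 1 := rfl
@[simp] lemma zero_apply (x : X) : (0 : BM X) x = 0 := rfl

lemma measurable (φ : BM X) : Measurable (fun x => φ x) := φ.2

lemma abs_apply_le (φ : BM X) (x : X) : |φ x| ≤ ‖φ‖ :=
  lp.norm_apply_le_norm ENNReal.top_ne_zero φ.1 x

lemma norm_le {φ : BM X} {C : ℝ} (hC : 0 ≤ C) (h : ∀ x, |φ x| ≤ C) : ‖φ‖ ≤ C :=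
  lp.norm_le_of_forall_le (f := φ.1) hC h

/-- A bounded measurable function as an element of `BM X`. -/
def mk (φ : X → ℝ) (hφ : Measurable φ) (h : ∃ C, ∀ x, |φ x| ≤ C) : BM X :=
  ⟨⟨φ, memℓp_infty (by
    obtain ⟨C, hC⟩ := h
    exact ⟨C, by rintro _ ⟨x, rfl⟩; exact hC x⟩)⟩, hφ⟩

lemma isClosed_boundedMeasurable :
    IsClosed (boundedMeasurable X : Set (lp (fun _ : X => ℝ) ⊤)) := by
  refine IsSeqClosed.isClosed fun u φ hu hφ => ?_
  refine measurable_of_tendsto_metrizable (f := fun n x => (u n : X → ℝ) x) (fun n => hu n) ?_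
  rw [tendsto_pi_nhds]
  intro x
  rw [tendsto_iff_norm_sub_tendsto_zero] at hφ ⊢
  refine squeeze_zero (fun _ => norm_nonneg _) (fun n => ?_) hφ
  exact lp.norm_apply_le_norm ENNReal.top_ne_zero (u n - φ) x

instance : CompleteSpace (BM X) :=
  isClosed_boundedMeasurable.isComplete.completeSpace_coe

/-- Evaluation at a point, as an algebra homomorphism. -/
def evalHom (x : X) : BM X →ₐ[ℝ] ℝ where
  toFun φ := φ x
  map_one' := rfl
  map_mul' _ _ := rfl
  map_zero' := rfl
  map_add' _ _ := rfl
  commutes' _ := rfl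

/-- Evaluation at a point, as a continuous linear functional. -/
def eval (x : X) : BM X →L[ℝ] ℝ :=
  (evalHom x).toLinearMap.mkContinuous 1 fun φ => by
    rw [one_mul]; exact φ.abs_apply_le x

@[simp] lemma eval_apply (x : X) (φ : BM X) : eval x φ = φ x := rfl

lemma exp_apply (φ : BM X) (x : X) : (NormedSpace.exp φ : BM X) x = Real.exp (φ x) := by
  let _ : NormedAlgebra ℚ (BM X) := NormedAlgebra.restrictScalars ℚ ℝ (BM X)
  rw [Real.exp_eq_exp_ℝ]
  exact NormedSpace.map_exp (evalHom x) (eval x).continuous φ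

/-- Precomposition with a measurable map. -/
def comap (g : X → Y) (hg : Measurable g) : BM Y →L[ℝ] BM X :=
  LinearMap.mkContinuous
    { toFun := fun φ => mk (fun x => φ (g x)) (φ.measurable.comp hg)
        ⟨‖φ‖, fun _ => φ.abs_apply_le _⟩
      map_add' := fun _ _ => rfl
      map_smul' := fun _ _ => rfl }
    1 fun φ => norm_le (by positivity) fun x => by
      rw [one_mul]; exact φ.abs_apply_le (g x)

lemma integrable (φ : BM X) (μ : Measure X) [IsFiniteMeasure μ] : Integrable (fun x => φ x) μ :=
  Integrable.of_bound φ.measurable.aestronglyMeasurable ‖φ‖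
    (ae_of_all _ fun x => φ.abs_apply_le x)

lemma abs_integral_le (φ : BM X) (μ : Measure X) [IsFiniteMeasure μ] :
    |∫ x, φ x ∂μ| ≤ μ.real Set.univ * ‖φ‖ := by
  have := norm_integral_le_of_norm_le_const (μ := μ) (f := fun x => φ x)
    (ae_of_all _ fun x => φ.abs_apply_le x)
  rwa [mul_comm] at this

/-- Integration against a finite measure. -/
def integral (μ : Measure X) [IsFiniteMeasure μ] : BM X →L[ℝ] ℝ :=
  LinearMap.mkContinuous
    { toFun := fun φ => ∫ x, φ x ∂μ
      map_add' := fun φ ψ => integral_add (φ.integrable μ) (ψ.integrable μ)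
      map_smul' := fun r _ => integral_const_mul r _ }
    (μ.real Set.univ) fun φ => abs_integral_le φ μ

@[simp] lemma integral_apply (μ : Measure X) [IsFiniteMeasure μ] (φ : BM X) :
    integral μ φ = ∫ x, φ x ∂μ := rfl

/-- The operator `φ ↦ (x ↦ ∫ φ dκ(x))` induced by a finite kernel. -/
def ofKernel (κ : ProbabilityTheory.Kernel X Y) [ProbabilityTheory.IsFiniteKernel κ] :
    BM Y →L[ℝ] BM X :=
  have h (φ : BM Y) (x : X) : |∫ y, φ y ∂(κ x)| ≤ κ.bound.toReal * ‖φ‖ :=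
    (φ.abs_integral_le (κ x)).trans (mul_le_mul_of_nonneg_right
      (ENNReal.toReal_mono (ProbabilityTheory.Kernel.bound_ne_top κ)
        (ProbabilityTheory.Kernel.measure_le_bound κ x Set.univ)) (norm_nonneg _))
  LinearMap.mkContinuous
    { toFun := fun φ => mk (fun x => ∫ y, φ y ∂(κ x))
        (φ.measurable.stronglyMeasurable.integral_kernel).measurable ⟨_, h φ⟩
      map_add' := fun φ ψ => by
        ext x; exact integral_add (φ.integrable _) (ψ.integrable _)
      map_smul' := fun r φ => by ext x; exact integral_const_mul r _ }
    κ.bound.toReal fun φ => norm_le (by positivity) (h φ)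

@[simp] lemma ofKernel_apply (κ : ProbabilityTheory.Kernel X Y)
    [ProbabilityTheory.IsFiniteKernel κ] (φ : BM Y) (x : X) :
    ofKernel κ φ x = ∫ y, φ y ∂(κ x) := rfl

/-- A curve of bounded measurable functions which is pointwise differentiable, with a derivative
that is continuous in supremum norm, is differentiable in supremum norm. -/
lemma hasDerivAt_of_pointwise {u u' : ℝ → BM X} (hu' : Continuous u')
    (h : ∀ x t, HasDerivAt (fun r => u r x) (u' t x) t) (t : ℝ) : HasDerivAt u (u' t) t := by
  have key : ∀ r, u r = u 0 + ∫ y in (0 : ℝ)..r, u' y := by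
    intro r
    ext x
    have h1 : eval x (∫ y in (0 : ℝ)..r, u' y) = ∫ y in (0 : ℝ)..r, u' y x :=
      ((eval x).intervalIntegral_comp_comm (hu'.intervalIntegrable 0 r)).symm
    have h2 : ∫ y in (0 : ℝ)..r, u' y x = u r x - u 0 x :=
      intervalIntegral.integral_eq_sub_of_hasDerivAt (fun y _ => h x y)
        (((eval x).continuous.comp hu').intervalIntegrable 0 r)
    rw [eval_apply] at h1
    rw [add_apply, h1, h2]; ring
  rw [funext key]
  exact (intervalIntegral.integral_hasDerivAt_right (hu'.intervalIntegrable 0 t)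
    (hu'.stronglyMeasurableAtFilter _ _) hu'.continuousAt).const_add _

end BM
/-! ### Markov operators and discounted resolvents -/

/-- A Markov operator: a positive unital operator between spaces of bounded measurable
functions. -/
structure IsMarkovOp {X Y : Type*} [MeasurableSpace X] [MeasurableSpace Y]
    (T : BM X →L[ℝ] BM Y) : Prop where
  nonneg : ∀ φ : BM X, (∀ x, 0 ≤ φ x) → ∀ y, 0 ≤ T φ y
  one : T 1 = 1

namespace IsMarkovOp

variable {X Y Z : Type*} [MeasurableSpace X] [MeasurableSpace Y] [MeasurableSpace Z]
  {T : BM X →L[ℝ] BM Y}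

lemma mono (hT : IsMarkovOp T) {φ ψ : BM X} (h : ∀ x, φ x ≤ ψ x) (y : Y) : T φ y ≤ T ψ y := by
  have := hT.nonneg (ψ - φ) (fun x => by simpa using h x) y
  simpa using this

lemma comp {U : BM Y →L[ℝ] BM Z} (hU : IsMarkovOp U) (hT : IsMarkovOp T) :
    IsMarkovOp (U ∘L T) where
  nonneg φ hφ z := hU.nonneg _ (hT.nonneg φ hφ) z
  one := by simp [hT.one, hU.one]

lemma le_const (hT : IsMarkovOp T) {φ : BM X} {C : ℝ} (h : ∀ x, φ x ≤ C) (y : Y) :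
    T φ y ≤ C := by
  have := hT.mono (ψ := C • 1) (fun x => by simpa using h x) y
  simpa [hT.one] using this

lemma abs_le (hT : IsMarkovOp T) {φ : BM X} {C : ℝ} (h : ∀ x, |φ x| ≤ C) (y : Y) :
    |T φ y| ≤ C := by
  refine _root_.abs_le.2 ⟨?_, hT.le_const (fun x => (_root_.abs_le.1 (h x)).2) y⟩
  have := hT.le_const (φ := -φ) (C := C) (fun x => by
    have := (_root_.abs_le.1 (h x)).1; simp; linarith) y
  simp at this; linarith

lemma norm_le_one (hT : IsMarkovOp T) : ‖T‖ ≤ 1 :=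
  T.opNorm_le_bound zero_le_one fun φ => by
    rw [one_mul]; exact BM.norm_le (norm_nonneg _) (hT.abs_le φ.abs_apply_le)

lemma sq_apply_mul_le (hT : IsMarkovOp T) (φ ψ : BM X) (y : Y) :
    (T (φ * ψ) y) ^ 2 ≤ T (φ * φ) y * T (ψ * ψ) y := by
  have h : ∀ r : ℝ, 0 ≤ T (φ * φ) y * (r * r) + 2 * T (φ * ψ) y * r + T (ψ * ψ) y := by
    intro r
    have := hT.nonneg ((r • φ + ψ) * (r • φ + ψ)) (fun x => mul_self_nonneg _) y
    have e : (r • φ + ψ) * (r • φ + ψ) = (r * r) • (φ * φ) + (2 * r) • (φ * ψ) + ψ * ψ := by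
      ext x; simp; ring
    rw [e] at this
    simp at this
    linarith
  have := discrim_le_zero h
  unfold discrim at this
  nlinarith

lemma sq_apply_le (hT : IsMarkovOp T) (φ : BM X) (y : Y) : (T φ y) ^ 2 ≤ T (φ * φ) y := by
  have := hT.sq_apply_mul_le φ 1 y
  simpa [hT.one] using this

end IsMarkovOp

/-- The discounted resolvent `(1 - δ T)⁻¹`. -/
def discountedResolvent {X : Type*} [MeasurableSpace X] (δ : ℝ) (T : BM X →L[ℝ] BM X) :
    BM X →L[ℝ] BM X :=
  Ring.inverse (1 - δ • T)

namespace IsMarkovOp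

variable {X : Type*} [MeasurableSpace X] {T : BM X →L[ℝ] BM X} {δ : ℝ}

lemma norm_smul_lt_one (hT : IsMarkovOp T) (hδ0 : 0 ≤ δ) (hδ1 : δ < 1) : ‖δ • T‖ < 1 := by
  rw [norm_smul, Real.norm_of_nonneg hδ0]
  nlinarith [hT.norm_le_one, norm_nonneg T]

lemma isUnit_one_sub (hT : IsMarkovOp T) (hδ0 : 0 ≤ δ) (hδ1 : δ < 1) : IsUnit (1 - δ • T) :=
  isUnit_one_sub_of_norm_lt_one (hT.norm_smul_lt_one hδ0 hδ1)

lemma resolvent_apply_sub (hT : IsMarkovOp T) (hδ0 : 0 ≤ δ) (hδ1 : δ < 1) (φ : BM X) :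
    discountedResolvent δ T (φ - δ • T φ) = φ :=
  congrArg (fun U : BM X →L[ℝ] BM X => U φ)
    (Ring.inverse_mul_cancel _ (hT.isUnit_one_sub hδ0 hδ1))

lemma resolvent_eq (hT : IsMarkovOp T) (hδ0 : 0 ≤ δ) (hδ1 : δ < 1) (φ : BM X) :
    discountedResolvent δ T φ = φ + δ • T (discountedResolvent δ T φ) := by
  have : discountedResolvent δ T φ - δ • T (discountedResolvent δ T φ) = φ :=
    congrArg (fun U : BM X →L[ℝ] BM X => U φ)
      (Ring.mul_inverse_cancel _ (hT.isUnit_one_sub hδ0 hδ1))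
  exact sub_eq_iff_eq_add.1 this

lemma hasSum_resolvent (hT : IsMarkovOp T) (hδ0 : 0 ≤ δ) (hδ1 : δ < 1) (φ : BM X) :
    HasSum (fun n : ℕ => δ ^ n • (T ^ n) φ) (discountedResolvent δ T φ) := by
  have h := hasSum_geom_series_inverse _ (hT.norm_smul_lt_one hδ0 hδ1)
  have h2 := (ContinuousLinearMap.apply ℝ (BM X) φ).hasSum h
  convert! h2 using 2 with n
  induction n with
  | zero => simp
  | succ n ih =>
    rw [pow_succ' T, pow_succ' (δ • T), pow_succ' δ]
    change (δ * δ ^ n) • T ((T ^ n) φ) = δ • T (((δ • T) ^ n) φ)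
    rw [mul_smul, ← map_smul, ih]
    rfl

lemma pow_nonneg (hT : IsMarkovOp T) (n : ℕ) {φ : BM X} (hφ : ∀ x, 0 ≤ φ x) :
    ∀ x, 0 ≤ (T ^ n) φ x := by
  induction n with
  | zero => simpa using hφ
  | succ n ih => rw [pow_succ']; exact hT.nonneg _ ih

lemma resolvent_nonneg (hT : IsMarkovOp T) (hδ0 : 0 ≤ δ) (hδ1 : δ < 1) {φ : BM X}
    (hφ : ∀ x, 0 ≤ φ x) (x : X) : 0 ≤ discountedResolvent δ T φ x :=
  ((BM.eval x).hasSum (hT.hasSum_resolvent hδ0 hδ1 φ)).nonneg fun n => by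
    simpa using mul_nonneg (_root_.pow_nonneg hδ0 n) (hT.pow_nonneg n hφ x)

lemma resolvent_mono (hT : IsMarkovOp T) (hδ0 : 0 ≤ δ) (hδ1 : δ < 1) {φ ψ : BM X}
    (h : ∀ x, φ x ≤ ψ x) (x : X) : discountedResolvent δ T φ x ≤ discountedResolvent δ T ψ x := by
  have := hT.resolvent_nonneg hδ0 hδ1 (φ := ψ - φ) (fun x => by simpa using h x) x
  simpa using this

lemma resolvent_one (hT : IsMarkovOp T) (hδ0 : 0 ≤ δ) (hδ1 : δ < 1) :
    discountedResolvent δ T 1 = (1 - δ)⁻¹ • 1 := by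
  have h := hT.resolvent_apply_sub hδ0 hδ1 ((1 - δ)⁻¹ • 1)
  have h1 : (1 - δ) ≠ 0 := by linarith
  have e : (1 - δ)⁻¹ • (1 : BM X) - δ • T ((1 - δ)⁻¹ • 1) = 1 := by
    ext x; simp [hT.one]; field_simp
  rwa [e] at h

lemma resolvent_le_const (hT : IsMarkovOp T) (hδ0 : 0 ≤ δ) (hδ1 : δ < 1) {φ : BM X} {C : ℝ}
    (h : ∀ x, φ x ≤ C) (x : X) : discountedResolvent δ T φ x ≤ C / (1 - δ) := by
  have := hT.resolvent_mono hδ0 hδ1 (ψ := C • 1) (fun x => by simpa using h x) x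
  rw [map_smul, hT.resolvent_one hδ0 hδ1] at this
  simpa [div_eq_mul_inv] using this

lemma abs_resolvent_le (hT : IsMarkovOp T) (hδ0 : 0 ≤ δ) (hδ1 : δ < 1) {φ : BM X} {C : ℝ}
    (h : ∀ x, |φ x| ≤ C) (x : X) : |discountedResolvent δ T φ x| ≤ C / (1 - δ) := by
  refine _root_.abs_le.2
    ⟨?_, hT.resolvent_le_const hδ0 hδ1 (fun x => (_root_.abs_le.1 (h x)).2) x⟩
  have := hT.resolvent_le_const hδ0 hδ1 (φ := -φ) (C := C) (fun x => by
    have := (_root_.abs_le.1 (h x)).1; simp; linarith) x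
  simp at this; linarith

/-- Cauchy-Schwarz for the discounted resolvent. -/
lemma abs_resolvent_le_of_sq_le (hT : IsMarkovOp T) (hδ0 : 0 ≤ δ) (hδ1 : δ < 1)
    {χ σ : BM X} {k a : ℝ} (hk : 0 ≤ k) (ha : 0 ≤ a) (h : ∀ x, χ x ^ 2 ≤ k ^ 2 * σ x)
    (hσ0 : ∀ x, 0 ≤ σ x) (hσ : ∀ x, discountedResolvent δ T σ x ≤ a ^ 2) (x : X) :
    |discountedResolvent δ T χ x| ≤ k * a / Real.sqrt (1 - δ) := by
  have hρ : 0 < Real.sqrt (1 - δ) := Real.sqrt_pos.2 (by linarith)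
  have hρ2 : Real.sqrt (1 - δ) ^ 2 = 1 - δ := Real.sq_sqrt (by linarith)
  have key : ∀ l > 0, ∀ ψ : BM X, (∀ x, ψ x ^ 2 ≤ k ^ 2 * σ x) →
      discountedResolvent δ T ψ x ≤ (l * a ^ 2 + (k / Real.sqrt (1 - δ)) ^ 2 / l) / 2 := by
    intro l hl ψ hψ
    have h1 : ∀ x, ψ x ≤ ((l / 2) • σ + (k ^ 2 / l / 2) • 1 : BM X) x := by
      intro x
      simp only [BM.add_apply, BM.smul_apply, BM.one_apply, mul_one]
      refine le_of_sq_le_sq ?_ (by have := hσ0 x; positivity)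
      refine (hψ x).trans ?_
      have e : l / 2 * σ x * (k ^ 2 / l / 2) * 4 = k ^ 2 * σ x := by field_simp; ring
      nlinarith [sq_nonneg (l / 2 * σ x - k ^ 2 / l / 2)]
    have h2 := hT.resolvent_mono hδ0 hδ1 h1 x
    rw [map_add, map_smul, map_smul, hT.resolvent_one hδ0 hδ1] at h2
    simp only [BM.add_apply, BM.smul_apply, BM.one_apply, mul_one] at h2
    have e : (k / Real.sqrt (1 - δ)) ^ 2 / l = k ^ 2 / l * (1 - δ)⁻¹ := by
      rw [div_pow, hρ2]; field_simp
    rw [e]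
    nlinarith [hσ x]
  have main : ∀ ψ : BM X, (∀ x, ψ x ^ 2 ≤ k ^ 2 * σ x) →
      discountedResolvent δ T ψ x ≤ k * a / Real.sqrt (1 - δ) := by
    intro ψ hψ
    set b := k / Real.sqrt (1 - δ) with hb
    have hb0 : 0 ≤ b := by positivity
    have : ∀ ε > 0, discountedResolvent δ T ψ x ≤ b * a + ε * (a + b) := by
      intro ε hε
      refine (key ((b + ε) / (a + ε)) (by positivity) ψ hψ).trans ?_
      have h1 : (b + ε) / (a + ε) * a ^ 2 ≤ (b + ε) * a := by
        rw [div_mul_eq_mul_div, div_le_iff₀ (by positivity)]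
        nlinarith [mul_nonneg (mul_nonneg (add_nonneg hb0 hε.le) ha) hε.le]
      have h2 : b ^ 2 / ((b + ε) / (a + ε)) ≤ (a + ε) * b := by
        rw [div_div_eq_mul_div, div_le_iff₀ (by positivity)]
        nlinarith [mul_nonneg (mul_nonneg (add_nonneg ha hε.le) hb0) hε.le]
      nlinarith [mul_nonneg hε.le ha, mul_nonneg hε.le hb0]
    have e : k * a / Real.sqrt (1 - δ) = b * a := by rw [hb]; ring
    rw [e]
    refine le_of_forall_pos_le_add fun ε hε => ?_
    refine (this (ε / (a + b + 1)) (by positivity)).trans ?_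
    have : ε / (a + b + 1) * (a + b) ≤ ε := by
      rw [div_mul_eq_mul_div, div_le_iff₀ (by positivity)]; nlinarith
    linarith
  refine _root_.abs_le.2 ⟨?_, main χ h⟩
  have := main (-χ) (fun x => by simpa using h x)
  simp at this; linarith

/-- Derivative of the solution of a discounted Poisson equation along a curve. -/
lemma hasDerivAt_resolvent {U : ℝ → BM X →L[ℝ] BM X} {U' : BM X →L[ℝ] BM X} {b : ℝ → BM X}
    {b' : BM X} {t : ℝ} (hT : IsMarkovOp (U t)) (hδ0 : 0 ≤ δ) (hδ1 : δ < 1)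
    (hU : HasDerivAt U U' t) (hb : HasDerivAt b b' t) :
    HasDerivAt (fun r => discountedResolvent δ (U r) (b r))
      (discountedResolvent δ (U t) (b' + δ • U' (discountedResolvent δ (U t) (b t)))) t := by
  obtain ⟨u, hu⟩ := hT.isUnit_one_sub hδ0 hδ1
  have h1 : HasDerivAt (fun r => 1 - δ • U r) (-(δ • U')) t := (hU.const_smul δ).const_sub 1
  have h2 := hasFDerivAt_ringInverse (𝕜 := ℝ) u
  rw [hu] at h2
  have h3 := h2.comp_hasDerivAt t h1
  have h4 := h3.clm_apply hb
  have e : (↑u⁻¹ : BM X →L[ℝ] BM X) = discountedResolvent δ (U t) := by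
    rw [discountedResolvent, ← hu, Ring.inverse_unit]
  refine h4.congr_deriv ?_
  rw [e]
  simp [discountedResolvent, add_comm]

end IsMarkovOp
/-! ### Covariance inequalities for Markov operators -/

lemma third_cumulant_aux {a b y z C : ℝ} (ha : 0 ≤ a) (hy : |y| ≤ a) (hz : |z| ≤ b)
    (hC : C ^ 2 ≤ (a ^ 2 - y ^ 2) * (b ^ 2 - z ^ 2)) :
    (a ^ 2 - y ^ 2) * (b ^ 2 - z ^ 2) + 4 * (y * z) * C - C ^ 2 ≤ a ^ 2 * b ^ 2 := by
  set M := a * b with hM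
  set P := |y| * |z| with hP
  have hP0 : 0 ≤ P := by positivity
  have hPM : P ≤ M := mul_le_mul hy hz (abs_nonneg _) ha
  have hP2 : P ^ 2 = y ^ 2 * z ^ 2 := by rw [hP, mul_pow, sq_abs, sq_abs]
  have hm : 2 * M * P ≤ a ^ 2 * z ^ 2 + b ^ 2 * y ^ 2 := by
    rw [hM, hP, ← sq_abs y, ← sq_abs z]
    nlinarith [sq_nonneg (a * |z| - b * |y|)]
  have hc : |C| ≤ M - P := by
    refine abs_le_of_sq_le_sq ?_ (by linarith)
    nlinarith
  have hPC : y * z * C ≤ P * |C| := by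
    refine (le_abs_self _).trans (le_of_eq ?_)
    rw [abs_mul, abs_mul]
  have hC2 : |C| ^ 2 = C ^ 2 := sq_abs C
  have hC0 := abs_nonneg C
  have key : 0 ≤ 2 * M * P - P ^ 2 - 4 * (P * |C|) + |C| ^ 2 := by
    by_cases h : 5 * P ≤ 2 * M
    · nlinarith [sq_nonneg (|C| - 2 * P)]
    · nlinarith [sq_nonneg (M - 2 * P), mul_nonneg (sub_nonneg.2 hc)
        (by linarith : 0 ≤ 3 * P - M + (2 * P - |C|))]
  nlinarith

namespace IsMarkovOp

variable {X Y : Type*} [MeasurableSpace X] [MeasurableSpace Y] {T : BM X →L[ℝ] BM Y}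

lemma apply_mul_self_le (hT : IsMarkovOp T) {φ : BM X} {a : ℝ} (h : ∀ x, |φ x| ≤ a) (y : Y) :
    T (φ * φ) y ≤ a ^ 2 :=
  hT.le_const (fun x => by
    have := sq_le_sq' (_root_.abs_le.1 (h x)).1 (_root_.abs_le.1 (h x)).2
    simpa [sq] using this) y

lemma sq_cov_le (hT : IsMarkovOp T) (φ ψ : BM X) (y : Y) :
    (T (φ * ψ) y - T φ y * T ψ y) ^ 2 ≤
      (T (φ * φ) y - T φ y ^ 2) * (T (ψ * ψ) y - T ψ y ^ 2) := by
  have h := hT.sq_apply_mul_le (φ - T φ y • 1) (ψ - T ψ y • 1) y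
  have e : ∀ φ ψ : BM X, T ((φ - T φ y • 1) * (ψ - T ψ y • 1)) y =
      T (φ * ψ) y - T φ y * T ψ y := by
    intro φ ψ
    have : (φ - T φ y • 1) * (ψ - T ψ y • 1) =
        φ * ψ - T φ y • ψ - T ψ y • φ + (T φ y * T ψ y) • 1 := by
      ext x; simp; ring
    rw [this]
    simp [hT.one]; ring
  rw [e, e, e] at h
  simpa [sq] using h

lemma abs_cov_le (hT : IsMarkovOp T) {φ ψ : BM X} {a b : ℝ} (ha : 0 ≤ a) (hb : 0 ≤ b)
    (hφ : ∀ x, |φ x| ≤ a) (hψ : ∀ x, |ψ x| ≤ b) (y : Y) :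
    |T (φ * ψ) y - T φ y * T ψ y| ≤ a * b := by
  refine abs_le_of_sq_le_sq ((hT.sq_cov_le φ ψ y).trans ?_) (by positivity)
  have h1 := hT.apply_mul_self_le hφ y
  have h2 := hT.apply_mul_self_le hψ y
  have h3 := hT.sq_apply_le ψ y
  rw [mul_pow]
  refine mul_le_mul ?_ ?_ (by linarith) (by positivity)
  · nlinarith [sq_nonneg (T φ y)]
  · nlinarith [sq_nonneg (T ψ y)]

/-- The product of two centred variables has variance at most the product of the squared
uniform bounds. -/
lemma var_mul_centered_le (hT : IsMarkovOp T) {φ ψ : BM X} {a b : ℝ} (ha : 0 ≤ a)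
    (hφ : ∀ x, |φ x| ≤ a) (hψ : ∀ x, |ψ x| ≤ b) (y : Y) :
    T (((φ - T φ y • 1) * (ψ - T ψ y • 1)) * ((φ - T φ y • 1) * (ψ - T ψ y • 1))) y -
      T ((φ - T φ y • 1) * (ψ - T ψ y • 1)) y ^ 2 ≤ a ^ 2 * b ^ 2 := by
  set u := T φ y with hu
  set v := T ψ y with hv
  have hW : T ((φ - u • 1) * (ψ - v • 1)) y = T (φ * ψ) y - u * v := by
    have : (φ - u • 1) * (ψ - v • 1) = φ * ψ - u • ψ - v • φ + (u * v) • 1 := by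
      ext x; simp; ring
    rw [this]
    simp [hT.one]; rw [← hu, ← hv]; ring
  set C := T (φ * ψ) y - u * v with hC
  have hub : |u| ≤ a := hT.abs_le hφ y
  have hvb : |v| ≤ b := hT.abs_le hψ y
  have hC2 : C ^ 2 ≤ (a ^ 2 - u ^ 2) * (b ^ 2 - v ^ 2) := by
    refine (hT.sq_cov_le φ ψ y).trans ?_
    have h1 := hT.apply_mul_self_le hφ y
    have h2 := hT.apply_mul_self_le hψ y
    have h3 := hT.sq_apply_le ψ y
    exact mul_le_mul (by linarith) (by linarith) (by linarith)
      (by have := sq_le_sq' (_root_.abs_le.1 hub).1 (_root_.abs_le.1 hub).2; linarith)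
  have hW2 : T (((φ - u • 1) * (ψ - v • 1)) * ((φ - u • 1) * (ψ - v • 1))) y ≤
      (a ^ 2 - u ^ 2) * (b ^ 2 - v ^ 2) + 4 * (u * v) * C := by
    have hle : ∀ x, (((φ - u • 1) * (ψ - v • 1)) * ((φ - u • 1) * (ψ - v • 1))) x ≤
        (((a ^ 2 + u ^ 2) * (b ^ 2 + v ^ 2)) • 1 - (2 * u * (b ^ 2 + v ^ 2)) • φ
          - (2 * v * (a ^ 2 + u ^ 2)) • ψ + (4 * u * v) • (φ * ψ) : BM X) x := by
      intro x
      have h1 := sq_le_sq' (_root_.abs_le.1 (hφ x)).1 (_root_.abs_le.1 (hφ x)).2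
      have h2 := sq_le_sq' (_root_.abs_le.1 (hψ x)).1 (_root_.abs_le.1 (hψ x)).2
      simp only [BM.add_apply, BM.sub_apply, BM.mul_apply, BM.smul_apply, BM.one_apply, mul_one]
      have h3 : (φ x - u) ^ 2 ≤ a ^ 2 + u ^ 2 - 2 * u * φ x := by nlinarith
      have h4 : (ψ x - v) ^ 2 ≤ b ^ 2 + v ^ 2 - 2 * v * ψ x := by nlinarith
      have h5 := mul_le_mul h3 h4 (sq_nonneg _) ((sq_nonneg _).trans h3)
      nlinarith
    refine (hT.mono hle y).trans (le_of_eq ?_)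
    simp only [map_add, map_sub, map_smul, hT.one, BM.add_apply, BM.sub_apply, BM.smul_apply,
      BM.one_apply]
    rw [← hu, ← hv, hC]; ring
  rw [hW]
  linarith [third_cumulant_aux ha hub hvb hC2]

/-- Third mixed central moments are controlled by the standard deviation of one factor and the
uniform bounds of the two others. -/
lemma sq_third_moment_le (hT : IsMarkovOp T) {χ φ ψ : BM X} {a b : ℝ} (ha : 0 ≤ a)
    (hφ : ∀ x, |φ x| ≤ a) (hψ : ∀ x, |ψ x| ≤ b) {y : Y} (hχ : T χ y = 0) :
    (T (χ * φ * ψ) y - T φ y * T (χ * ψ) y - T (χ * φ) y * T ψ y) ^ 2 ≤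
      (a * b) ^ 2 * T (χ * χ) y := by
  have h := hT.sq_cov_le χ ((φ - T φ y • 1) * (ψ - T ψ y • 1)) y
  have e : χ * ((φ - T φ y • 1) * (ψ - T ψ y • 1)) =
      χ * φ * ψ - T φ y • (χ * ψ) - T ψ y • (χ * φ) + (T φ y * T ψ y) • χ := by
    ext x; simp; ring
  rw [e] at h
  simp only [map_add, map_sub, map_smul, BM.add_apply, BM.sub_apply, BM.smul_apply, hχ] at h
  have h0 := hT.nonneg (χ * χ) (fun x => mul_self_nonneg _) y
  have h1 := mul_le_mul_of_nonneg_left (hT.var_mul_centered_le ha hφ hψ y) h0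
  nlinarith

lemma sq_apply_mul_le_of_abs_le (hT : IsMarkovOp T) {χ φ : BM X} {a : ℝ}
    (hφ : ∀ x, |φ x| ≤ a) (y : Y) : T (χ * φ) y ^ 2 ≤ a ^ 2 * T (χ * χ) y := by
  have h0 := hT.nonneg (χ * χ) (fun x => mul_self_nonneg _) y
  have h1 := hT.apply_mul_self_le hφ y
  have := hT.sq_apply_mul_le χ φ y
  nlinarith

end IsMarkovOp
/-! ### Softmax averages over the action variable -/

section Softmax

variable {S A : Type*} [MeasurableSpace S] [MeasurableSpace A]

/-- Integration over the action variable against a finite reference measure. -/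
def integrateAction (η : Measure A) [IsFiniteMeasure η] : BM (S × A) →L[ℝ] BM S :=
  BM.ofKernel (ProbabilityTheory.Kernel.id.prod (ProbabilityTheory.Kernel.const S η))

/-- A function of the state, seen as a function of state and action. -/
def liftState : BM S →L[ℝ] BM (S × A) := BM.comap Prod.fst measurable_fst

@[simp] lemma liftState_apply (v : BM S) (p : S × A) : liftState v p = v p.1 := rfl

variable (η : Measure A) [IsFiniteMeasure η]

lemma integrateAction_apply (φ : BM (S × A)) (s : S) :
    integrateAction η φ s = ∫ a, φ (s, a) ∂η := by
  rw [integrateAction, BM.ofKernel_apply, ProbabilityTheory.Kernel.prod_apply,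
    ProbabilityTheory.Kernel.id_apply, ProbabilityTheory.Kernel.const_apply, Measure.dirac_prod,
    integral_map measurable_prodMk_left.aemeasurable φ.measurable.aestronglyMeasurable]

lemma BM.integrable_section (φ : BM (S × A)) (s : S) : Integrable (fun a => φ (s, a)) η :=
  (BM.comap (Prod.mk s) measurable_prodMk_left φ).integrable η

lemma integrateAction_exp_apply (F : BM (S × A)) (s : S) :
    integrateAction η (NormedSpace.exp F) s = ∫ a, Real.exp (F (s, a)) ∂η := by
  simp_rw [integrateAction_apply, BM.exp_apply]

lemma integrable_exp_section (F : BM (S × A)) (s : S) :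
    Integrable (fun a => Real.exp (F (s, a))) η := by
  simpa only [BM.exp_apply] using BM.integrable_section η (NormedSpace.exp F) s

variable [NeZero η]

lemma integrateAction_exp_pos (F : BM (S × A)) (s : S) :
    0 < integrateAction η (NormedSpace.exp F) s := by
  rw [integrateAction_exp_apply]
  exact integral_exp_pos (integrable_exp_section η F s)

lemma log_integrateAction_exp_le {F G : BM (S × A)} {C : ℝ} {s : S}
    (h : ∀ a, F (s, a) ≤ G (s, a) + C) :
    Real.log (integrateAction η (NormedSpace.exp F) s)
      ≤ Real.log (integrateAction η (NormedSpace.exp G) s) + C := by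
  rw [← Real.log_exp C, ← Real.log_mul (integrateAction_exp_pos η G s).ne' (Real.exp_pos _).ne']
  refine Real.log_le_log (integrateAction_exp_pos η F s) ?_
  rw [integrateAction_exp_apply, integrateAction_exp_apply, ← integral_mul_const]
  refine integral_mono (integrable_exp_section η F s)
    ((integrable_exp_section η G s).mul_const _) fun a => ?_
  simp only [← Real.exp_add]
  exact Real.exp_le_exp.2 (h a)

lemma abs_log_integrateAction_exp_sub_le (F G : BM (S × A)) (s : S) :
    |Real.log (integrateAction η (NormedSpace.exp F) s)
      - Real.log (integrateAction η (NormedSpace.exp G) s)| ≤ ‖F - G‖ := by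
  have h (a : A) := abs_le.1 ((F - G).abs_apply_le (s, a))
  simp only [BM.sub_apply] at h
  have h1 := log_integrateAction_exp_le η (F := F) (G := G) (C := ‖F - G‖) (s := s)
    fun a => by linarith [(h a).2]
  have h2 := log_integrateAction_exp_le η (F := G) (G := F) (C := ‖F - G‖) (s := s)
    fun a => by linarith [(h a).1]
  exact abs_le.2 ⟨by linarith, by linarith⟩

omit [NeZero η] in
lemma log_integrateAction_exp_zero (s : S) :
    Real.log (integrateAction η (NormedSpace.exp (0 : BM (S × A))) s)
      = Real.log (η Set.univ).toReal := by
  rw [integrateAction_exp_apply]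
  simp [Measure.real]

lemma abs_log_integrateAction_exp_le (F : BM (S × A)) (s : S) :
    |Real.log (integrateAction η (NormedSpace.exp F) s)|
      ≤ ‖F‖ + |Real.log (η Set.univ).toReal| := by
  have h := abs_log_integrateAction_exp_sub_le η F 0 s
  rw [log_integrateAction_exp_zero, sub_zero] at h
  calc _ = |Real.log (integrateAction η (NormedSpace.exp F) s) - Real.log (η Set.univ).toReal
        + Real.log (η Set.univ).toReal| := by rw [sub_add_cancel]
    _ ≤ _ := (abs_add_le _ _).trans (by gcongr)

/-- The log-partition function `s ↦ log ∫ exp (F (s, a)) η(da)`. -/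
def logPartition (F : BM (S × A)) : BM S :=
  BM.mk (fun s => Real.log (integrateAction η (NormedSpace.exp F) s))
    (integrateAction η (NormedSpace.exp F)).measurable.log
    ⟨_, abs_log_integrateAction_exp_le η F⟩

/-- The log-density of the softmax policy with potential `F`. -/
def logDensity (F : BM (S × A)) : BM (S × A) := F - liftState (logPartition η F)

/-- Averages under the softmax policy with potential `F`. -/
def softmaxMean (F : BM (S × A)) : BM (S × A) →L[ℝ] BM S :=
  integrateAction η ∘L ContinuousLinearMap.mul ℝ _ (NormedSpace.exp (logDensity η F))

lemma softmaxMean_eq (F φ : BM (S × A)) :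
    softmaxMean η F φ = integrateAction η (NormedSpace.exp (logDensity η F) * φ) := rfl

lemma logPartition_apply (F : BM (S × A)) (s : S) :
    logPartition η F s = Real.log (integrateAction η (NormedSpace.exp F) s) := rfl

lemma logDensity_apply (F : BM (S × A)) (p : S × A) :
    logDensity η F p = F p - logPartition η F p.1 := rfl

lemma abs_logDensity_le (F : BM (S × A)) (p : S × A) :
    |logDensity η F p| ≤ 2 * ‖F‖ + |Real.log (η Set.univ).toReal| := by
  have h1 := abs_log_integrateAction_exp_le η F p.1
  have h2 := F.abs_apply_le p
  rw [logDensity_apply, logPartition_apply]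
  exact (abs_sub _ _).trans (by linarith)

lemma exp_logDensity_apply (F : BM (S × A)) (s : S) (a : A) :
    Real.exp (logDensity η F (s, a)) =
      Real.exp (F (s, a)) / integrateAction η (NormedSpace.exp F) s := by
  rw [logDensity_apply, logPartition_apply, Real.exp_sub,
    Real.exp_log (integrateAction_exp_pos η F s)]

lemma softmaxMean_apply (F φ : BM (S × A)) (s : S) :
    softmaxMean η F φ s =
      ∫ a, Real.exp (logDensity η F (s, a)) * φ (s, a) ∂η := by
  rw [softmaxMean_eq, integrateAction_apply]
  simp_rw [BM.mul_apply, BM.exp_apply]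

lemma softmaxMean_apply_eq_div (F φ : BM (S × A)) (s : S) :
    softmaxMean η F φ s = integrateAction η (NormedSpace.exp F * φ) s
      / integrateAction η (NormedSpace.exp F) s := by
  rw [softmaxMean_apply, integrateAction_apply η (NormedSpace.exp F * φ), ← integral_div]
  simp_rw [exp_logDensity_apply, BM.mul_apply, BM.exp_apply, div_mul_eq_mul_div]

lemma isMarkovOp_softmaxMean (F : BM (S × A)) : IsMarkovOp (softmaxMean η F) where
  nonneg φ hφ s := by
    rw [softmaxMean_apply]
    exact integral_nonneg fun a => mul_nonneg (Real.exp_pos _).le (hφ _)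
  one := by
    ext s
    rw [softmaxMean_apply_eq_div, mul_one, BM.one_apply,
      div_self (integrateAction_exp_pos η F s).ne']

lemma softmaxMean_lift_mul (F : BM (S × A)) (v : BM S) (φ : BM (S × A)) :
    softmaxMean η F (liftState v * φ) = v * softmaxMean η F φ := by
  ext s
  rw [BM.mul_apply, softmaxMean_apply, softmaxMean_apply, ← integral_const_mul]
  refine integral_congr_ae (ae_of_all _ fun a => ?_)
  simp only [BM.mul_apply, liftState_apply]
  ring

lemma softmaxMean_lift (F : BM (S × A)) (v : BM S) :
    softmaxMean η F (liftState v) = v := by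
  have := softmaxMean_lift_mul η F v 1
  rwa [mul_one, (isMarkovOp_softmaxMean η F).one, mul_one] at this

lemma continuous_logPartition : Continuous (logPartition η : BM (S × A) → BM S) := by
  refine LipschitzWith.continuous (K := 1) (LipschitzWith.of_dist_le_mul fun F G => ?_)
  rw [dist_eq_norm, dist_eq_norm, NNReal.coe_one, one_mul]
  exact BM.norm_le (norm_nonneg _) (abs_log_integrateAction_exp_sub_le η F G)

lemma BM.continuous_exp {X : Type*} [MeasurableSpace X] :
    Continuous (NormedSpace.exp : BM X → BM X) :=
  let _ : NormedAlgebra ℚ (BM X) := NormedAlgebra.restrictScalars ℚ ℝ (BM X)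
  NormedSpace.exp_continuous

lemma BM.hasDerivAt_exp {X : Type*} [MeasurableSpace X] {u : ℝ → BM X} {u' : BM X} {t : ℝ}
    (hu : HasDerivAt u u' t) :
    HasDerivAt (fun r => NormedSpace.exp (u r)) (NormedSpace.exp (u t) * u') t :=
  ((hasFDerivAt_exp (𝕂 := ℝ) (x := u t)).comp_hasDerivAt t hu).congr_deriv rfl

lemma continuous_softmaxMean :
    Continuous (softmaxMean η : BM (S × A) → BM (S × A) →L[ℝ] BM S) := by
  have h : Continuous (fun F : BM (S × A) => NormedSpace.exp (logDensity η F)) :=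
    BM.continuous_exp.comp
      (continuous_id.sub (liftState.continuous.comp (continuous_logPartition η)))
  exact continuous_const.clm_comp ((ContinuousLinearMap.mul ℝ (BM (S × A))).continuous.comp h)

variable (F D : BM (S × A)) (t : ℝ)

lemma hasDerivAt_line : HasDerivAt (fun r : ℝ => F + r • D) D t := by
  simpa using ((hasDerivAt_id t).smul_const D).const_add F

lemma hasDerivAt_logPartition :
    HasDerivAt (fun r : ℝ => logPartition η (F + r • D)) (softmaxMean η (F + t • D) D) t := by
  refine BM.hasDerivAt_of_pointwise (u' := fun r => softmaxMean η (F + r • D) D) ?_ ?_ t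
  · exact ((continuous_softmaxMean η).comp (by fun_prop)).clm_apply continuous_const
  · intro s t
    have h1 := ((BM.eval s).hasFDerivAt.comp_hasDerivAt t ((integrateAction η).hasFDerivAt
      |>.comp_hasDerivAt t (BM.hasDerivAt_exp (hasDerivAt_line F D t))))
    have h2 := h1.log (integrateAction_exp_pos η _ s).ne'
    rw [softmaxMean_apply_eq_div]
    exact h2

/-- The score of the softmax policy in direction `D`. -/
def score : BM (S × A) := D - liftState (softmaxMean η F D)

lemma hasDerivAt_logDensity :
    HasDerivAt (fun r : ℝ => logDensity η (F + r • D)) (score η (F + t • D) D) t :=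
  (hasDerivAt_line F D t).sub
    (liftState.hasFDerivAt.comp_hasDerivAt t (hasDerivAt_logPartition η F D t))

lemma hasDerivAt_softmaxMean :
    HasDerivAt (fun r : ℝ => softmaxMean η (F + r • D))
      (softmaxMean η (F + t • D) ∘L ContinuousLinearMap.mul ℝ _ (score η (F + t • D) D)) t := by
  have h1 := BM.hasDerivAt_exp (hasDerivAt_logDensity η F D t)
  have h2 := (ContinuousLinearMap.mul ℝ (BM (S × A))).hasFDerivAt.comp_hasDerivAt t h1
  have h3 := (hasDerivAt_const t (integrateAction (S := S) η)).clm_comp h2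
  convert! h3 using 1
  ext1 φ
  simp [softmaxMean_eq, mul_assoc]

end Softmax

/-! ### Entropy-regularized Markov decision processes with softmax policies -/

/-- The data of an entropy-regularized discounted Markov decision process: a finite nonzero
reference measure on actions, a transition operator, a bounded cost, a discount factor and a
temperature. -/
structure RegularizedMDP (S A : Type*) [MeasurableSpace S] [MeasurableSpace A] where
  ref : Measure A
  [isFiniteMeasure_ref : IsFiniteMeasure ref]
  [neZero_ref : NeZero ref]
  next : BM S →L[ℝ] BM (S × A)
  isMarkovOp_next : IsMarkovOp next
  cost : BM (S × A)
  discount : ℝ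
  discount_nonneg : 0 ≤ discount
  discount_lt_one : discount < 1
  temp : ℝ

namespace RegularizedMDP

variable {S A : Type*} [MeasurableSpace S] [MeasurableSpace A] (M : RegularizedMDP S A)
  (F D h k : BM (S × A))

attribute [instance] isFiniteMeasure_ref neZero_ref

/-- Average over the action chosen by the softmax policy with potential `F`. -/
def mean : BM (S × A) →L[ℝ] BM S := softmaxMean M.ref F

/-- The state transition operator under the softmax policy. -/
def transition : BM S →L[ℝ] BM S := M.mean F ∘L M.next

/-- The discounted occupation operator under the softmax policy. -/
def occupation : BM S →L[ℝ] BM S := discountedResolvent M.discount (M.transition F)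

/-- The one-step cost including the entropic penalty. -/
def regCost : BM (S × A) := M.cost + M.temp • logDensity M.ref F

/-- The value function. -/
def value : BM S := M.occupation F (M.mean F (M.regCost F))

/-- The state-action value function, including the entropic penalty. -/
def qValue : BM (S × A) := M.regCost F + M.discount • M.next (M.value F)

/-- The advantage function. -/
def advantage : BM (S × A) := M.qValue F - liftState (M.value F)

/-- The derivative of the value function with respect to the potential. -/
def valueDeriv : BM (S × A) →L[ℝ] BM S :=
  M.occupation F ∘L M.mean F ∘L ContinuousLinearMap.mul ℝ _ (M.advantage F)

lemma valueDeriv_apply : M.valueDeriv F h = M.occupation F (M.mean F (M.advantage F * h)) := rfl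

lemma transition_apply (v : BM S) : M.transition F v = M.mean F (M.next v) := rfl

lemma isMarkovOp_mean : IsMarkovOp (M.mean F) := isMarkovOp_softmaxMean M.ref F

lemma isMarkovOp_transition : IsMarkovOp (M.transition F) :=
  (M.isMarkovOp_mean F).comp M.isMarkovOp_next

lemma mean_lift_mul (v : BM S) : M.mean F (liftState v * h) = v * M.mean F h :=
  softmaxMean_lift_mul M.ref F v h

lemma mean_lift (v : BM S) : M.mean F (liftState v) = v := softmaxMean_lift M.ref F v

lemma occupation_eq (v : BM S) :
    M.occupation F v = v + M.discount • M.transition F (M.occupation F v) :=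
  (M.isMarkovOp_transition F).resolvent_eq M.discount_nonneg M.discount_lt_one v

lemma mean_qValue : M.mean F (M.qValue F) = M.value F := by
  rw [qValue, map_add, map_smul]
  exact (M.occupation_eq F _).symm

lemma mean_advantage : M.mean F (M.advantage F) = 0 := by
  rw [advantage, map_sub, mean_qValue, mean_lift, sub_self]

lemma mean_score_mul :
    M.mean F (score M.ref F D * h) = M.mean F (D * h) - M.mean F D * M.mean F h := by
  rw [score, sub_mul, map_sub, mean_lift_mul]
  rfl

lemma mean_score : M.mean F (score M.ref F D) = 0 := by
  have := M.mean_score_mul F D 1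
  rwa [mul_one, mul_one, (M.isMarkovOp_mean F).one, mul_one, sub_self] at this

variable (t : ℝ)

lemma hasDerivAt_mean {u : ℝ → BM (S × A)} {u' : BM (S × A)} (hu : HasDerivAt u u' t) :
    HasDerivAt (fun r => M.mean (F + r • D) (u r))
      (M.mean (F + t • D) (score M.ref (F + t • D) D * u t + u')) t := by
  rw [map_add]
  exact (hasDerivAt_softmaxMean M.ref F D t).clm_apply hu

lemma hasDerivAt_transition :
    HasDerivAt (fun r : ℝ => M.transition (F + r • D))
      (M.mean (F + t • D) ∘L ContinuousLinearMap.mul ℝ _ (score M.ref (F + t • D) D) ∘L M.next)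
      t := by
  have := (hasDerivAt_softmaxMean M.ref F D t).clm_comp (hasDerivAt_const t M.next)
  convert! this using 1
  ext1 v
  simp [mean]

lemma hasDerivAt_occupation {b : ℝ → BM S} {b' : BM S} (hb : HasDerivAt b b' t) :
    HasDerivAt (fun r => M.occupation (F + r • D) (b r))
      (M.occupation (F + t • D) (b' + M.discount • M.mean (F + t • D)
        (score M.ref (F + t • D) D * M.next (M.occupation (F + t • D) (b t))))) t := by
  have h := IsMarkovOp.hasDerivAt_resolvent (U := fun r => M.transition (F + r • D)) (b := b)
    (M.isMarkovOp_transition (F + t • D)) M.discount_nonneg M.discount_lt_one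
    (M.hasDerivAt_transition F D t) hb
  simp only [ContinuousLinearMap.comp_apply, ContinuousLinearMap.mul_apply'] at h
  exact h

lemma hasDerivAt_regCost :
    HasDerivAt (fun r : ℝ => M.regCost (F + r • D)) (M.temp • score M.ref (F + t • D) D) t :=
  ((hasDerivAt_logDensity M.ref F D t).const_smul M.temp).const_add M.cost

/-- The policy gradient theorem. -/
theorem hasDerivAt_value :
    HasDerivAt (fun r : ℝ => M.value (F + r • D)) (M.valueDeriv (F + t • D) D) t := by
  have h1 := M.hasDerivAt_occupation F D t
    (M.hasDerivAt_mean F D t (M.hasDerivAt_regCost F D t))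
  convert! h1 using 1
  set G := F + t • D
  have e : score M.ref G D * M.regCost G + M.temp • score M.ref G D
      + M.discount • (score M.ref G D * M.next (M.value G))
      = score M.ref G D * M.advantage G + M.temp • score M.ref G D
        + liftState (M.value G) * score M.ref G D := by
    ext p; simp [advantage, qValue]; ring
  have e2 := congrArg (M.mean G) e
  rw [map_add, map_smul, map_add, map_add, map_add, map_smul, mean_lift_mul, mean_score,
    smul_zero, mul_zero, add_zero, add_zero,
    M.mean_score_mul G D (M.advantage G), mean_advantage, mul_zero, sub_zero, mul_comm D] at e2
  rw [map_add (M.mean G), map_smul (M.mean G), mean_score, smul_zero, add_zero, valueDeriv_apply,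
    ← add_zero (M.mean G (M.advantage G * D)), ← e2]
  rfl

lemma hasDerivAt_advantage :
    HasDerivAt (fun r : ℝ => M.advantage (F + r • D))
      (M.temp • score M.ref (F + t • D) D
        + M.discount • M.next (M.valueDeriv (F + t • D) D)
        - liftState (M.valueDeriv (F + t • D) D)) t := by
  have h := M.hasDerivAt_value F D t
  exact ((M.hasDerivAt_regCost F D t).add
    ((M.next.hasFDerivAt.comp_hasDerivAt t h).const_smul M.discount)).sub
      (liftState.hasFDerivAt.comp_hasDerivAt t h)

/-- The source term of the derivative of the policy gradient: `h` is a fixed function minus the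
potential, and `D` is the direction of differentiation. -/
def valueSecondSource : BM S :=
  (M.mean F (M.advantage F * D * h) - M.mean F D * M.mean F (M.advantage F * h)
      - M.mean F (M.advantage F * D) * M.mean F h)
    - M.mean F (M.advantage F * D)
    + (M.temp • (M.mean F (D * h) - M.mean F D * M.mean F h)
      + M.discount • (M.mean F (M.next (M.valueDeriv F D) * h)
          - M.mean F (M.next (M.valueDeriv F D)) * M.mean F h)
      + M.discount • (M.mean F (D * M.next (M.valueDeriv F h))
          - M.mean F D * M.mean F (M.next (M.valueDeriv F h))))

theorem hasDerivAt_valueDeriv :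
    HasDerivAt (fun r : ℝ => M.valueDeriv (F + r • D) (k - (F + r • D)))
      (M.occupation (F + t • D)
        (M.valueSecondSource (F + t • D) D (k - (F + t • D)))) t := by
  have h1 := M.hasDerivAt_occupation F D t (M.hasDerivAt_mean F D t
    ((M.hasDerivAt_advantage F D t).mul ((hasDerivAt_line F D t).const_sub k)))
  convert! h1 using 2
  dsimp only [Pi.mul_apply]
  rw [← valueDeriv_apply]
  set G := F + t • D
  set h := k - G
  have e : (M.temp • score M.ref G D + M.discount • M.next (M.valueDeriv G D)
      - liftState (M.valueDeriv G D)) * h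
      = M.temp • (score M.ref G D * h) + M.discount • (M.next (M.valueDeriv G D) * h)
        - liftState (M.valueDeriv G D) * h := by
    ext p; simp; ring
  have e2 : M.valueDeriv G D = M.mean G (M.advantage G * D)
      + M.discount • M.mean G (M.next (M.valueDeriv G D)) := M.occupation_eq G _
  rw [e, map_add, map_add, map_sub, map_add, map_smul, map_smul, mean_lift_mul, mean_score_mul,
    mean_score_mul, mean_score_mul, mul_neg, map_neg]
  have e3 : M.valueDeriv G D * M.mean G h = M.mean G (M.advantage G * D) * M.mean G h
      + M.discount • (M.mean G (M.next (M.valueDeriv G D)) * M.mean G h) := by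
    conv_lhs => rw [e2]
    ext s; simp; ring
  have e4 : D * (M.advantage G * h) = M.advantage G * D * h := by ring
  rw [e3, e4, valueSecondSource]
  ext s
  simp only [BM.add_apply, BM.sub_apply, BM.smul_apply, BM.mul_apply, BM.neg_apply]
  ring

section Bounds

variable {F D h} {B : ℝ}

/-- The discounted sum of the variances of the state-action values. -/
lemma occupation_sq_advantage_le (hB : ∀ p, |M.regCost F p| ≤ B) (s : S) :
    M.occupation F (M.mean F (M.advantage F * M.advantage F)) s ≤ (B / (1 - M.discount)) ^ 2 := by
  have hδ0 := M.discount_nonneg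
  have hδ1 := M.discount_lt_one
  have hρ : 0 < 1 - M.discount := by linarith
  set V := M.value F with hV
  have h1 : M.mean F (M.advantage F * M.advantage F)
      = M.mean F (M.qValue F * M.qValue F) - V * V := by
    have e : M.advantage F * M.advantage F = M.qValue F * M.qValue F
        - (2 : ℝ) • (liftState V * M.qValue F) + liftState V * liftState V := by
      ext p; simp [advantage, hV]; ring
    rw [e, map_add, map_sub, map_smul, mean_lift_mul, mean_lift_mul, mean_lift, mean_qValue]
    ext x; simp [hV]; ring
  have h2 : ∀ p, (M.qValue F * M.qValue F) p ≤
      ((B ^ 2 / (1 - M.discount)) • (1 : BM (S × A)) + M.discount • M.next (V * V)) p := by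
    intro p
    have h3 := M.isMarkovOp_next.sq_apply_le V p
    have h4 := sq_le_sq' (abs_le.1 (hB p)).1 (abs_le.1 (hB p)).2
    simp only [BM.mul_apply, BM.add_apply, BM.smul_apply, BM.one_apply, qValue, mul_one]
    rw [← hV, div_add' _ _ _ hρ.ne', le_div_iff₀ hρ]
    nlinarith [mul_nonneg hδ0 (sq_nonneg (M.regCost F p - (1 - M.discount) * M.next V p)),
      mul_nonneg (mul_nonneg hδ0 hρ.le) (sub_nonneg.2 h3)]
  have h5 := (M.isMarkovOp_transition F).resolvent_mono hδ0 hδ1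
    (φ := M.mean F (M.advantage F * M.advantage F))
    (ψ := (B ^ 2 / (1 - M.discount)) • 1 - (V * V - M.discount • M.transition F (V * V)))
    (fun x => by
      have := (M.isMarkovOp_mean F).mono h2 x
      rw [map_add, map_smul, map_smul, (M.isMarkovOp_mean F).one] at this
      rw [h1]
      simp only [BM.mul_apply, BM.add_apply, BM.smul_apply, BM.one_apply, BM.sub_apply,
        transition_apply] at this ⊢
      linarith) s
  rw [map_sub, (M.isMarkovOp_transition F).resolvent_apply_sub hδ0 hδ1, map_smul,
    (M.isMarkovOp_transition F).resolvent_one hδ0 hδ1] at h5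
  simp only [BM.mul_apply, BM.smul_apply, BM.one_apply, BM.sub_apply] at h5
  refine h5.trans ?_
  have : B ^ 2 / (1 - M.discount) * ((1 - M.discount)⁻¹ * 1) = (B / (1 - M.discount)) ^ 2 := by
    field_simp
  rw [this]
  nlinarith [mul_self_nonneg (V s)]

lemma mean_sq_advantage_nonneg (s : S) : 0 ≤ M.mean F (M.advantage F * M.advantage F) s :=
  (M.isMarkovOp_mean F).nonneg _ (fun _ => mul_self_nonneg _) s

lemma abs_occupation_le_of_sq_le (hB0 : 0 ≤ B) (hB : ∀ p, |M.regCost F p| ≤ B) {χ : BM S} {a : ℝ}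
    (ha : 0 ≤ a)
    (hχ : ∀ s, χ s ^ 2 ≤ a ^ 2 * M.mean F (M.advantage F * M.advantage F) s) (s : S) :
    |M.occupation F χ s| ≤ a * (B / (1 - M.discount)) / √(1 - M.discount) :=
  (M.isMarkovOp_transition F).abs_resolvent_le_of_sq_le M.discount_nonneg M.discount_lt_one ha
    (div_nonneg hB0 (by linarith [M.discount_lt_one])) hχ (fun _ => M.mean_sq_advantage_nonneg _)
    (M.occupation_sq_advantage_le hB) s

lemma abs_valueDeriv_le (hB0 : 0 ≤ B) (hB : ∀ p, |M.regCost F p| ≤ B) {a : ℝ} (ha : 0 ≤ a)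
    (hD : ∀ p, |D p| ≤ a) (s : S) :
    |M.valueDeriv F D s| ≤ a * (B / (1 - M.discount)) / √(1 - M.discount) :=
  M.abs_occupation_le_of_sq_le hB0 hB ha
    ((M.isMarkovOp_mean F).sq_apply_mul_le_of_abs_le hD) s

lemma abs_occupation_valueSecondSource_le (hτ : 0 ≤ M.temp) (hB0 : 0 ≤ B)
    (hB : ∀ p, |M.regCost F p| ≤ B) {a b : ℝ} (ha : 0 ≤ a) (hb : 0 ≤ b)
    (hD : ∀ p, |D p| ≤ a) (hh : ∀ p, |h p| ≤ b) (s : S) :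
    |M.occupation F (M.valueSecondSource F D h) s| ≤
      a * b * (B / (1 - M.discount)) / √(1 - M.discount)
        + a * (B / (1 - M.discount)) / √(1 - M.discount)
        + (M.temp * (a * b) + M.discount * (2 * (a * b * (B / (1 - M.discount))
          / √(1 - M.discount)))) / (1 - M.discount) := by
  have hE := M.isMarkovOp_mean F
  have hρ : 0 < 1 - M.discount := by linarith [M.discount_lt_one]
  rw [valueSecondSource, map_add, map_sub]
  refine (abs_add_le _ _).trans (add_le_add ((abs_sub _ _).trans (add_le_add ?_ ?_)) ?_)
  · refine M.abs_occupation_le_of_sq_le hB0 hB (mul_nonneg ha hb) (fun x => ?_) s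
    refine hE.sq_third_moment_le ha hD hh ?_
    rw [mean_advantage, BM.zero_apply]
  · exact M.abs_valueDeriv_le hB0 hB ha hD s
  · refine (M.isMarkovOp_transition F).abs_resolvent_le M.discount_nonneg M.discount_lt_one
      (fun x => ?_) s
    simp only [BM.add_apply, BM.smul_apply, BM.sub_apply, BM.mul_apply]
    have hK : 0 ≤ B / (1 - M.discount) / √(1 - M.discount) := by positivity
    have h1 := hE.abs_cov_le ha hb hD hh x
    have h2 := hE.abs_cov_le (φ := M.next (M.valueDeriv F D)) (mul_nonneg ha hK) hb
      (M.isMarkovOp_next.abs_le fun y =>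
        (M.abs_valueDeriv_le hB0 hB ha hD y).trans_eq (by ring)) hh x
    have h3 := hE.abs_cov_le (ψ := M.next (M.valueDeriv F h)) ha (mul_nonneg hb hK) hD
      (M.isMarkovOp_next.abs_le fun y =>
        (M.abs_valueDeriv_le hB0 hB hb hh y).trans_eq (by ring)) x
    calc _ ≤ M.temp * (a * b) + M.discount * (a * (B / (1 - M.discount) / √(1 - M.discount)) * b)
          + M.discount * (a * (b * (B / (1 - M.discount) / √(1 - M.discount)))) := by
          refine (abs_add_le _ _).trans (add_le_add ((abs_add_le _ _).trans (add_le_add ?_ ?_)) ?_)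
          · rw [abs_mul, abs_of_nonneg hτ]; gcongr
          · rw [abs_mul, abs_of_nonneg M.discount_nonneg]; gcongr; exact M.discount_nonneg
          · rw [abs_mul, abs_of_nonneg M.discount_nonneg]; gcongr; exact M.discount_nonneg
      _ = _ := by ring

end Bounds

end RegularizedMDP

lemma second_derivative_bound_le {ρ n B τ a : ℝ} (hρ0 : 0 < ρ) (hρ1 : ρ ≤ 1) (hn : 0 ≤ n)
    (hτ : 0 ≤ τ) (hB : 2 * τ * n ≤ B) (ha : 0 ≤ a) :
    a * (2 * n) * (B / ρ) / √ρ + a * (B / ρ) / √ρ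
        + (τ * (a * (2 * n)) + (1 - ρ) * (2 * (a * (2 * n) * (B / ρ) / √ρ))) / ρ
      ≤ a * (1 / ρ ^ 2 * B * max 2 (5 / ρ * n) + 4 * τ * n) := by
  obtain ⟨s, hs0, rfl⟩ : ∃ s, 0 < s ∧ ρ = s ^ 2 :=
    ⟨√ρ, Real.sqrt_pos.2 hρ0, (Real.sq_sqrt hρ0.le).symm⟩
  have hs1 : s ≤ 1 := by nlinarith
  rw [Real.sqrt_sq hs0.le]
  set m := max 2 (5 / s ^ 2 * n) with hm
  have hm1 : 2 ≤ m := le_max_left _ _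
  have hm2 : 5 * n ≤ m * s ^ 2 := by
    have : 5 / s ^ 2 * n ≤ m := le_max_right _ _
    rwa [div_mul_eq_mul_div, div_le_iff₀ (by positivity)] at this
  have hτn : 0 ≤ 2 * τ * n := by positivity
  have hB0 : 0 ≤ B := hτn.trans hB
  have hp : s ^ 2 * (1 - 2 * s ^ 2) ≤ 2 * (1 - 13 / 10 * s + 2 / 5 * s ^ 3) := by
    nlinarith [sq_nonneg (s ^ 2 - 1 / 2), sq_nonneg (s - 7 / 10), pow_pos hs0 3,
      mul_nonneg hs0.le (sq_nonneg (s - 3 / 4))]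
  have hp0 : 0 ≤ 1 - 13 / 10 * s + 2 / 5 * s ^ 3 := by
    nlinarith [mul_nonneg (sub_nonneg.2 hs1) hs0.le, mul_nonneg (sub_nonneg.2 hs1)
      (mul_nonneg hs0.le hs0.le), mul_nonneg (sub_nonneg.2 hs1) (sq_nonneg (s - 1))]
  have h1 : 2 * τ * n * (s ^ 2 * (1 - 2 * s ^ 2))
      ≤ B * m * (1 - 13 / 10 * s + 2 / 5 * s ^ 3) := by
    have h3 : B * (2 * (1 - 13 / 10 * s + 2 / 5 * s ^ 3))
        ≤ B * m * (1 - 13 / 10 * s + 2 / 5 * s ^ 3) := by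
      rw [mul_assoc]
      gcongr
    rcases le_total 0 (1 - 2 * s ^ 2) with h2 | h2
    · calc _ ≤ B * (s ^ 2 * (1 - 2 * s ^ 2)) := by gcongr
        _ ≤ B * (2 * (1 - 13 / 10 * s + 2 / 5 * s ^ 3)) := by gcongr
        _ ≤ _ := h3
    · refine le_trans (mul_nonpos_of_nonneg_of_nonpos hτn
        (mul_nonpos_of_nonneg_of_nonpos (sq_nonneg s) h2)) (le_trans ?_ h3)
      positivity
  have h2 : 2 * n * B * s ^ 2 + B * s ^ 2 + 2 * τ * n * s ^ 3 + 4 * (1 - s ^ 2) * n * B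
      ≤ B * s * m + 4 * τ * n * s ^ 5 := by
    have h3 : B * ((4 - 2 * s ^ 2) * (5 * n)) ≤ B * ((4 - 2 * s ^ 2) * (m * s ^ 2)) := by
      gcongr
      nlinarith
    have h4 : B * s ^ 2 * 2 ≤ B * s ^ 2 * m := by gcongr
    have h5 := mul_le_mul_of_nonneg_left h1 hs0.le
    linarith
  have e1 : a * (2 * n) * (B / s ^ 2) / s + a * (B / s ^ 2) / s
        + (τ * (a * (2 * n)) + (1 - s ^ 2) * (2 * (a * (2 * n) * (B / s ^ 2) / s))) / s ^ 2
      = a * ((2 * n * B * s ^ 2 + B * s ^ 2 + 2 * τ * n * s ^ 3 + 4 * (1 - s ^ 2) * n * B)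
        / s ^ 5) := by
    field_simp; ring
  have e2 : a * (1 / (s ^ 2) ^ 2 * B * m + 4 * τ * n)
      = a * ((B * s * m + 4 * τ * n * s ^ 5) / s ^ 5) := by
    field_simp
  rw [e1, e2]
  gcongr

namespace RegularizedMDP

variable {S A : Type*} [MeasurableSpace S] [MeasurableSpace A] (M : RegularizedMDP S A)
  {F G k : BM (S × A)} {C n : ℝ}

lemma abs_regCost_le (hτ : 0 ≤ M.temp) (hC : ∀ p, |M.cost p| ≤ C) (hF : ‖F‖ ≤ n)
    (p : S × A) :
    |M.regCost F p| ≤ C + M.temp * (2 * n + |Real.log (M.ref Set.univ).toReal|) := by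
  refine (abs_add_le _ _).trans (add_le_add (hC p) ?_)
  rw [BM.smul_apply, abs_mul, abs_of_nonneg hτ]
  gcongr
  exact (abs_logDensity_le M.ref F p).trans (by gcongr)

/-- The centered policy gradient is Lipschitz in the potential. -/
lemma norm_valueDeriv_sub_le (hτ : 0 ≤ M.temp) (hC0 : 0 ≤ C) (hC : ∀ p, |M.cost p| ≤ C)
    (hF : ‖F‖ ≤ n) (hG : ‖G‖ ≤ n) (hk : ‖k‖ ≤ n) :
    ‖M.valueDeriv G (k - G) - M.valueDeriv F (k - F)‖ ≤ ‖G - F‖ *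
      (1 / (1 - M.discount) ^ 2 * (C + M.temp * (2 * n + |Real.log (M.ref Set.univ).toReal|))
        * max 2 (5 / (1 - M.discount) * n) + 4 * M.temp * n) := by
  have hn : 0 ≤ n := (norm_nonneg _).trans hF
  set B := C + M.temp * (2 * n + |Real.log (M.ref Set.univ).toReal|) with hB
  have hBn : 2 * M.temp * n ≤ B := by
    have : 0 ≤ M.temp * |Real.log (M.ref Set.univ).toReal| := by positivity
    rw [hB]; linarith
  have hB0 : 0 ≤ B := by positivity
  have key := norm_image_sub_le_of_norm_deriv_le_segment_01'
    (f := fun r : ℝ => M.valueDeriv (F + r • (G - F)) (k - (F + r • (G - F))))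
    (C := ‖G - F‖ * (1 / (1 - M.discount) ^ 2 * B
        * max 2 (5 / (1 - M.discount) * n) + 4 * M.temp * n))
    (fun t _ => (M.hasDerivAt_valueDeriv F (G - F) k t).hasDerivWithinAt) fun t ht => by
      have hseg : ‖F + t • (G - F)‖ ≤ n := by
        have e : F + t • (G - F) = (1 - t) • F + t • G := by
          rw [smul_sub, sub_smul, one_smul]; abel
        rw [e]
        refine (norm_add_le _ _).trans ?_
        rw [norm_smul, norm_smul, Real.norm_of_nonneg ht.1,
          Real.norm_of_nonneg (by linarith [ht.2])]
        nlinarith [mul_le_mul_of_nonneg_left hF (by linarith [ht.2] : 0 ≤ 1 - t),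
          mul_le_mul_of_nonneg_left hG ht.1]
      have hbound := second_derivative_bound_le (ρ := 1 - M.discount)
        (by linarith [M.discount_lt_one]) (by linarith [M.discount_nonneg]) hn hτ hBn
        (norm_nonneg (G - F))
      refine le_trans (BM.norm_le ?_ fun s => ?_) hbound
      · have := M.discount_nonneg
        have := M.discount_lt_one
        rw [sub_sub_cancel]
        have : 0 < 1 - M.discount := by linarith
        positivity
      · have h := M.abs_occupation_valueSecondSource_le (F := F + t • (G - F)) (D := G - F)
          (h := k - (F + t • (G - F))) (b := 2 * n) hτ hB0 (M.abs_regCost_le hτ hC hseg)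
          (norm_nonneg _) (by positivity) (G - F).abs_apply_le
          (fun p => (BM.abs_apply_le _ p).trans ((norm_sub_le _ _).trans (by linarith))) s
        rwa [sub_sub_cancel]
  simpa using key

lemma norm_valueDeriv_le (hτ : 0 ≤ M.temp) (hC0 : 0 ≤ C) (hC : ∀ p, |M.cost p| ≤ C)
    (hF : ‖F‖ ≤ n) :
    ‖M.valueDeriv F k‖ ≤ ‖k‖ * (1 / (1 - M.discount) ^ 2 *
      (C + M.temp * (2 * n + |Real.log (M.ref Set.univ).toReal|))) := by
  have hn : 0 ≤ n := (norm_nonneg _).trans hF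
  have hρ : 0 < 1 - M.discount := by linarith [M.discount_lt_one]
  set B := C + M.temp * (2 * n + |Real.log (M.ref Set.univ).toReal|) with hB
  have hB0 : 0 ≤ B := by positivity
  refine BM.norm_le (by positivity) fun s => ?_
  refine (M.abs_valueDeriv_le hB0 (M.abs_regCost_le hτ hC hF) (norm_nonneg k)
    k.abs_apply_le s).trans ?_
  have h1 : 1 - M.discount ≤ √(1 - M.discount) :=
    Real.le_sqrt_of_sq_le (by nlinarith [M.discount_nonneg])
  calc _ ≤ ‖k‖ * (B / (1 - M.discount)) / (1 - M.discount) := by gcongr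
    _ = _ := by field_simp

end RegularizedMDP

/-! ### Softmax policies as measures -/

lemma BM.integral_bind {X Y : Type*} [MeasurableSpace X] [MeasurableSpace Y] (μ : Measure X)
    [IsFiniteMeasure μ] (κ : ProbabilityTheory.Kernel X Y) [ProbabilityTheory.IsMarkovKernel κ]
    (φ : BM Y) : ∫ y, φ y ∂(μ.bind κ) = ∫ x, BM.ofKernel κ φ x ∂μ := by
  have h := ProbabilityTheory.Kernel.integral_comp (η := κ)
    (κ := ProbabilityTheory.Kernel.const Unit μ) (a := ()) (f := fun y => φ y) (φ.integrable _)
  rwa [ProbabilityTheory.Kernel.comp_apply, ProbabilityTheory.Kernel.const_apply] at h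

lemma BM.isMarkovOp_ofKernel {X Y : Type*} [MeasurableSpace X] [MeasurableSpace Y]
    (κ : ProbabilityTheory.Kernel X Y) [ProbabilityTheory.IsMarkovKernel κ] :
    IsMarkovOp (BM.ofKernel κ) where
  nonneg φ hφ x := integral_nonneg hφ
  one := by ext x; simp

namespace RegularizedMDP

variable {S A : Type*} [MeasurableSpace S] [MeasurableSpace A]

/-- The softmax policy with potential `F`, as a kernel from states to actions. -/
def policy (M : RegularizedMDP S A) (F : BM (S × A)) : ProbabilityTheory.Kernel S A :=
  (ProbabilityTheory.Kernel.const S M.ref).withDensity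
    fun s a => ENNReal.ofReal (Real.exp (logDensity M.ref F (s, a)))

section Policy

variable (M : RegularizedMDP S A) (F : BM (S × A))

lemma policy_apply (s : S) : M.policy F s =
    M.ref.withDensity fun a => ENNReal.ofReal (Real.exp (logDensity M.ref F (s, a))) := by
  rw [policy, ProbabilityTheory.Kernel.withDensity_apply, ProbabilityTheory.Kernel.const_apply]
  exact (logDensity M.ref F).measurable.exp.ennreal_ofReal

lemma measurable_policy_density (s : S) :
    Measurable fun a => ENNReal.ofReal (Real.exp (logDensity M.ref F (s, a))) :=
  ((logDensity M.ref F).measurable.comp measurable_prodMk_left).exp.ennreal_ofReal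

lemma integral_policy (φ : BM (S × A)) (s : S) :
    ∫ a, φ (s, a) ∂(M.policy F s) = M.mean F φ s := by
  rw [policy_apply, integral_withDensity_eq_integral_toReal_smul
    (M.measurable_policy_density F s) (ae_of_all _ fun _ => ENNReal.ofReal_lt_top), mean,
    softmaxMean_apply]
  simp_rw [ENNReal.toReal_ofReal (Real.exp_pos _).le, smul_eq_mul]

instance isMarkovKernel_policy : ProbabilityTheory.IsMarkovKernel (M.policy F) := by
  refine ⟨fun s => ⟨?_⟩⟩
  have h := M.integral_policy F 1 s
  rw [(M.isMarkovOp_mean F).one] at h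
  simp only [BM.one_apply, integral_const, smul_eq_mul, mul_one] at h
  rwa [Measure.real, ENNReal.toReal_eq_one_iff] at h

lemma runCost_policy (s : S) :
    runCost (fun s a => M.cost (s, a)) M.temp M.ref (M.policy F) s
      = M.mean F (M.regCost F) s := by
  rw [← integral_policy, runCost]
  refine integral_congr_ae ?_
  have h := Measure.rnDeriv_withDensity M.ref (M.measurable_policy_density F s)
  rw [← policy_apply] at h
  have hac : M.policy F s ≪ M.ref := by
    rw [policy_apply]; exact withDensity_absolutelyContinuous _ _
  filter_upwards [hac.ae_le h] with a ha
  rw [ha, ENNReal.toReal_ofReal (Real.exp_pos _).le, Real.log_exp]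
  rfl

end Policy

section Chain

variable (κ : ProbabilityTheory.Kernel (S × A) S) [ProbabilityTheory.IsMarkovKernel κ]

/-- The transition kernel of the state process under a stationary policy. -/
def stateKernel (κ : ProbabilityTheory.Kernel (S × A) S) (π : ProbabilityTheory.Kernel S A) :
    ProbabilityTheory.Kernel S S :=
  κ.comp (ProbabilityTheory.Kernel.id.prod π)

instance isMarkovKernel_stateKernel (π : ProbabilityTheory.Kernel S A)
    [ProbabilityTheory.IsMarkovKernel π] :
    ProbabilityTheory.IsMarkovKernel (stateKernel κ π) := by
  unfold stateKernel; infer_instance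

omit [ProbabilityTheory.IsMarkovKernel κ] in
lemma stepMeas_eq_bind (π : ProbabilityTheory.Kernel S A) [ProbabilityTheory.IsMarkovKernel π]
    (γ : Measure S) :
    stepMeas (fun s a => κ (s, a)) π γ = γ.bind (stateKernel κ π) := by
  rw [stepMeas]
  congr 1
  ext1 s
  rw [stateKernel, ProbabilityTheory.Kernel.comp_apply, ProbabilityTheory.Kernel.prod_apply,
    ProbabilityTheory.Kernel.id_apply, Measure.dirac_prod, Measure.bind, Measure.bind,
    Measure.map_map κ.measurable measurable_prodMk_left]
  rfl

instance isProbabilityMeasure_stepMeas (π : ProbabilityTheory.Kernel S A)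
    [ProbabilityTheory.IsMarkovKernel π] (γ : Measure S) [IsProbabilityMeasure γ] :
    IsProbabilityMeasure (stepMeas (fun s a => κ (s, a)) π γ) := by
  rw [stepMeas_eq_bind]; infer_instance

variable {κ} {M : RegularizedMDP S A} (hM : M.next = BM.ofKernel κ) (F : BM (S × A))
include hM

lemma integral_stepMeas (γ : Measure S) [IsProbabilityMeasure γ] (v : BM S) :
    ∫ s, v s ∂(stepMeas (fun s a => κ (s, a)) (M.policy F) γ)
      = ∫ s, M.transition F v s ∂γ := by
  rw [stepMeas_eq_bind, BM.integral_bind]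
  refine integral_congr_ae (ae_of_all _ fun s => ?_)
  have h := BM.integral_bind ((ProbabilityTheory.Kernel.id.prod (M.policy F)) s) κ v
  simp only [BM.ofKernel_apply, stateKernel, ProbabilityTheory.Kernel.comp_apply]
  rw [h, ProbabilityTheory.Kernel.prod_apply, ProbabilityTheory.Kernel.id_apply,
    Measure.dirac_prod, integral_map measurable_prodMk_left.aemeasurable
      (BM.ofKernel κ v).measurable.aestronglyMeasurable, integral_policy, transition_apply, hM]

lemma integral_iterate_stepMeas (n : ℕ) (γ : Measure S) [IsProbabilityMeasure γ] (v : BM S) :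
    ∫ s, v s ∂((stepMeas (fun s a => κ (s, a)) (M.policy F))^[n] γ)
      = ∫ s, (M.transition F ^ n) v s ∂γ := by
  induction n generalizing γ with
  | zero => rfl
  | succ n ih =>
    rw [Function.iterate_succ_apply, ih, integral_stepMeas hM, pow_succ']
    rfl

theorem Vtau_policy (γ : Measure S) [IsProbabilityMeasure γ] :
    Vtau (fun s a => κ (s, a)) (fun s a => M.cost (s, a)) M.discount M.temp M.ref (M.policy F) γ
      = ∫ s, M.value F s ∂γ := by
  have h := (BM.integral γ).hasSum ((M.isMarkovOp_transition F).hasSum_resolvent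
    M.discount_nonneg M.discount_lt_one (M.mean F (M.regCost F)))
  rw [Vtau, ← BM.integral_apply γ, value, occupation, ← h.tsum_eq]
  congr 1 with n
  simp_rw [runCost_policy]
  rw [integral_iterate_stepMeas hM]
  exact ((BM.integral γ).map_smul _ _).symm

end Chain

end RegularizedMDP
/-! ### Kantorovich–Rubinstein estimates -/

section Wasserstein

variable {d : ℕ} {ν ν' : Measure (Ed d)} {g : Ed d → ℝ}

lemma IsP1.integrable_of_lipschitzWith (hν : IsP1 ν) (hg : LipschitzWith 1 g) :
    Integrable g ν := by
  have := hν.1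
  refine ((integrable_const |g 0|).add hν.2).mono' hg.continuous.aestronglyMeasurable
    (ae_of_all _ fun x => ?_)
  have h := hg.dist_le_mul x 0
  rw [Real.dist_eq, dist_zero_right, NNReal.coe_one, one_mul] at h
  rw [Pi.add_apply, Real.norm_eq_abs]
  linarith [abs_sub_abs_le_abs_sub (g x) (g 0)]

lemma IsP1.abs_integral_sub_le (hν : IsP1 ν) (hg : LipschitzWith 1 g) :
    |∫ x, g x ∂ν - g 0| ≤ ∫ x, ‖x‖ ∂ν := by
  have := hν.1
  have h0 : ∫ x, (g x - g 0) ∂ν = ∫ x, g x ∂ν - g 0 := by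
    rw [integral_sub (hν.integrable_of_lipschitzWith hg) (integrable_const _)]; simp
  rw [← h0, ← Real.norm_eq_abs]
  refine norm_integral_le_of_norm_le hν.2 (ae_of_all _ fun x => ?_)
  have h := hg.dist_le_mul x 0
  rwa [dist_eq_norm, dist_zero_right, NNReal.coe_one, one_mul] at h

lemma integral_sub_le_W1 (hν : IsP1 ν) (hν' : IsP1 ν') (hg : LipschitzWith 1 g) :
    ∫ x, g x ∂ν - ∫ x, g x ∂ν' ≤ W1 ν ν' := by
  refine le_ciSup (f := fun g : {g : Ed d → ℝ // LipschitzWith 1 g} =>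
    ∫ x, g.1 x ∂ν - ∫ x, g.1 x ∂ν') ⟨∫ x, ‖x‖ ∂ν + ∫ x, ‖x‖ ∂ν', ?_⟩ ⟨g, hg⟩
  rintro _ ⟨g, rfl⟩
  have h1 := abs_le.1 (hν.abs_integral_sub_le g.2)
  have h2 := abs_le.1 (hν'.abs_integral_sub_le g.2)
  linarith [h1.2, h2.1]

lemma W1_nonneg (hν : IsP1 ν) (hν' : IsP1 ν') : 0 ≤ W1 ν ν' := by
  simpa using integral_sub_le_W1 hν hν' (g := fun _ => 0) (LipschitzWith.const' 0)

lemma abs_integral_sub_le_mul_W1 (hν : IsP1 ν) (hν' : IsP1 ν') {L : ℝ} (hL : 0 ≤ L)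
    (hg : ∀ x y, |g x - g y| ≤ L * ‖x - y‖) :
    |∫ x, g x ∂ν - ∫ x, g x ∂ν'| ≤ L * W1 ν ν' := by
  have := hν.1
  have := hν'.1
  rcases hL.eq_or_lt with rfl | hL
  · have h0 : g = fun _ => g 0 := by
      funext x
      have := hg x 0
      rw [zero_mul, abs_nonpos_iff] at this
      linarith
    rw [h0]; simp
  · have hlip (r : ℝ) (hr : |r| = L⁻¹) : LipschitzWith 1 fun x => r * g x := by
      refine LipschitzWith.of_dist_le_mul fun x y => ?_
      rw [Real.dist_eq, ← mul_sub, abs_mul, hr, dist_eq_norm, NNReal.coe_one, one_mul,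
        inv_mul_le_iff₀ hL]
      exact hg x y
    have h1 := integral_sub_le_W1 hν hν' (hlip L⁻¹ (abs_of_pos (inv_pos.2 hL)))
    have h2 := integral_sub_le_W1 hν hν' (hlip (-L⁻¹)
      (by rw [abs_neg, abs_of_pos (inv_pos.2 hL)]))
    simp only [integral_const_mul] at h1 h2
    rw [← mul_sub, inv_mul_le_iff₀ hL] at h1
    rw [← mul_sub, neg_mul, ← mul_neg, inv_mul_le_iff₀ hL] at h2
    exact abs_le.2 ⟨by linarith, h1⟩

end Wasserstein

/-! ### Mean-field potentials -/

section Potential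

variable {d : ℕ} {X : Type*} [MeasurableSpace X] {K : Ed d → BM X}

lemma continuous_of_norm_sub_le {L : ℝ} (hL : 0 ≤ L) (hK : ∀ θ θ', ‖K θ - K θ'‖ ≤ L * ‖θ - θ'‖) :
    Continuous K :=
  (LipschitzWith.of_dist_le_mul (K := ⟨L, hL⟩) fun θ θ' => by
    rw [dist_eq_norm, dist_eq_norm]; exact hK θ θ').continuous

lemma integrable_of_norm_le (hc : Continuous K) {n : ℝ} (hn : ∀ θ, ‖K θ‖ ≤ n)
    (ν : Measure (Ed d)) [IsFiniteMeasure ν] : Integrable K ν :=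
  Integrable.of_bound hc.aestronglyMeasurable n (ae_of_all _ hn)

lemma integral_apply_of_norm_le (hc : Continuous K) {n : ℝ} (hn : ∀ θ, ‖K θ‖ ≤ n)
    (ν : Measure (Ed d)) [IsFiniteMeasure ν] (x : X) :
    (∫ θ, K θ ∂ν : BM X) x = ∫ θ, K θ x ∂ν :=
  ((BM.eval x).integral_comp_comm (integrable_of_norm_le hc hn ν)).symm

lemma norm_integral_le_of_isP1 {n : ℝ} (hn : ∀ θ, ‖K θ‖ ≤ n) {ν : Measure (Ed d)} (hν : IsP1 ν) :
    ‖∫ θ, K θ ∂ν‖ ≤ n := by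
  have := hν.1
  simpa using norm_integral_le_of_norm_le_const (μ := ν) (ae_of_all _ hn)

lemma integral_mix (hc : Continuous K) {n : ℝ} (hn : ∀ θ, ‖K θ‖ ≤ n) (ν ν' : Measure (Ed d))
    [IsFiniteMeasure ν] [IsFiniteMeasure ν'] {ε : ℝ} (h0 : 0 ≤ ε) (h1 : ε ≤ 1) :
    ∫ θ, K θ ∂(mix ν ν' ε) = ∫ θ, K θ ∂ν + ε • (∫ θ, K θ ∂ν' - ∫ θ, K θ ∂ν) := by
  rw [mix, integral_add_measure
    ((integrable_of_norm_le hc hn ν).smul_measure ENNReal.ofReal_ne_top)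
    ((integrable_of_norm_le hc hn ν').smul_measure ENNReal.ofReal_ne_top),
    integral_smul_measure, integral_smul_measure, ENNReal.toReal_ofReal h0,
    ENNReal.toReal_ofReal (sub_nonneg.2 h1)]
  module

lemma isProbabilityMeasure_mix (ν ν' : Measure (Ed d)) [IsProbabilityMeasure ν]
    [IsProbabilityMeasure ν'] {ε : ℝ} (h0 : 0 ≤ ε) (h1 : ε ≤ 1) :
    IsProbabilityMeasure (mix ν ν' ε) := by
  refine ⟨?_⟩
  rw [mix]
  simp only [Measure.coe_add, Measure.coe_smul, Pi.add_apply, Pi.smul_apply, measure_univ,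
    smul_eq_mul, mul_one]
  rw [← ENNReal.ofReal_add (sub_nonneg.2 h1) h0, sub_add_cancel, ENNReal.ofReal_one]

lemma norm_integral_sub_le_mul_W1 {L : ℝ} (hL : 0 ≤ L)
    (hK : ∀ θ θ', ‖K θ - K θ'‖ ≤ L * ‖θ - θ'‖) {n : ℝ} (hn : ∀ θ, ‖K θ‖ ≤ n)
    {ν ν' : Measure (Ed d)} (hν : IsP1 ν) (hν' : IsP1 ν') :
    ‖∫ θ, K θ ∂ν - ∫ θ, K θ ∂ν'‖ ≤ L * W1 ν ν' := by
  have := hν.1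
  have := hν'.1
  have hc := continuous_of_norm_sub_le hL hK
  refine BM.norm_le (mul_nonneg hL (W1_nonneg hν hν')) fun x => ?_
  rw [BM.sub_apply, integral_apply_of_norm_le hc hn, integral_apply_of_norm_le hc hn]
  exact abs_integral_sub_le_mul_W1 hν hν' hL fun θ θ' =>
    ((K θ - K θ').abs_apply_le x).trans (hK θ θ')

end Potential

namespace RegularizedMDP

section MeanField

variable {d : ℕ} {S A : Type*} [MeasurableSpace S] [MeasurableSpace A] (M : RegularizedMDP S A)
  (γ : Measure S) [IsProbabilityMeasure γ] (K : Ed d → BM (S × A))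

/-- The flat derivative of `ν ↦ ∫ M.value (∫ K dν) dγ`. -/
def flatDeriv (ν : Measure (Ed d)) (θ : Ed d) : ℝ :=
  BM.integral γ (M.valueDeriv (∫ θ', K θ' ∂ν) (K θ - ∫ θ', K θ' ∂ν))

variable {K} {C n L : ℝ}

lemma abs_integral_le_norm (v : BM S) : |BM.integral γ v| ≤ ‖v‖ := by
  simpa using BM.abs_integral_le v γ

lemma integral_flatDeriv (hc : Continuous K) (hn : ∀ θ, ‖K θ‖ ≤ n) (ν ν' : Measure (Ed d))
    [IsProbabilityMeasure ν'] :
    ∫ θ, M.flatDeriv γ K ν θ ∂ν'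
      = BM.integral γ (M.valueDeriv (∫ θ, K θ ∂ν) (∫ θ, K θ ∂ν' - ∫ θ, K θ ∂ν)) := by
  have hi := integrable_of_norm_le hc hn ν'
  have h := ((BM.integral γ).comp (M.valueDeriv (∫ θ, K θ ∂ν))).integral_comp_comm
    (hi.sub (integrable_const (∫ θ, K θ ∂ν)))
  simp only [Pi.sub_apply] at h
  rw [integral_sub hi (integrable_const _), integral_const, probReal_univ, one_smul] at h
  exact h

variable (hτ : 0 ≤ M.temp) (hC0 : 0 ≤ C) (hC : ∀ p, |M.cost p| ≤ C) (hn : ∀ θ, ‖K θ‖ ≤ n)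
include hτ hC0 hC hn

lemma abs_flatDeriv_le {ν : Measure (Ed d)} (hν : IsP1 ν) (θ : Ed d) :
    |M.flatDeriv γ K ν θ| ≤ 2 / (1 - M.discount) ^ 2
      * (C + M.temp * (2 * n + |Real.log (M.ref Set.univ).toReal|)) * n := by
  have hF := norm_integral_le_of_isP1 hn hν
  have hn0 : 0 ≤ n := (norm_nonneg _).trans hF
  refine (abs_integral_le_norm γ _).trans ((M.norm_valueDeriv_le hτ hC0 hC hF).trans ?_)
  have h : ‖K θ - ∫ θ', K θ' ∂ν‖ ≤ 2 * n :=
    (norm_sub_le _ _).trans (by linarith [hn θ])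
  calc _ ≤ 2 * n * (1 / (1 - M.discount) ^ 2
        * (C + M.temp * (2 * n + |Real.log (M.ref Set.univ).toReal|))) := by gcongr
    _ = _ := by ring

lemma abs_flatDeriv_sub_le (hL : 0 ≤ L) (hK : ∀ θ θ', ‖K θ - K θ'‖ ≤ L * ‖θ - θ'‖)
    {ν ν' : Measure (Ed d)} (hν : IsP1 ν) (hν' : IsP1 ν') (θ θ' : Ed d) :
    |M.flatDeriv γ K ν' θ' - M.flatDeriv γ K ν θ| ≤
      L * (1 / (1 - M.discount) ^ 2
          * (C + M.temp * (2 * n + |Real.log (M.ref Set.univ).toReal|))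
          * max 2 (5 / (1 - M.discount) * n) + 4 * M.temp * n) * (‖θ' - θ‖ + W1 ν' ν) := by
  have hF := norm_integral_le_of_isP1 hn hν
  have hG := norm_integral_le_of_isP1 hn hν'
  have hn0 : 0 ≤ n := (norm_nonneg _).trans hF
  have hd := norm_integral_sub_le_mul_W1 hL hK hn hν' hν
  set F := ∫ θ, K θ ∂ν
  set G := ∫ θ, K θ ∂ν'
  set Q := 1 / (1 - M.discount) ^ 2
    * (C + M.temp * (2 * n + |Real.log (M.ref Set.univ).toReal|)) with hQ
  have hQ0 : 0 ≤ Q := by positivity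
  have hW := W1_nonneg hν' hν
  have hmax : Q ≤ Q * max 2 (5 / (1 - M.discount) * n) + 4 * M.temp * n := by
    have h1 : Q * 1 ≤ Q * max 2 (5 / (1 - M.discount) * n) :=
      mul_le_mul_of_nonneg_left (le_max_of_le_left one_le_two) hQ0
    have h2 : 0 ≤ 4 * M.temp * n := by positivity
    linarith
  set R := Q * max 2 (5 / (1 - M.discount) * n) + 4 * M.temp * n
  have hR0 : 0 ≤ R := hQ0.trans hmax
  have hsplit : M.flatDeriv γ K ν' θ' - M.flatDeriv γ K ν θ
      = BM.integral γ (M.valueDeriv G (K θ' - G) - M.valueDeriv F (K θ' - F))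
        + BM.integral γ (M.valueDeriv F (K θ' - K θ)) := by
    simp only [flatDeriv, map_sub]
    ring
  rw [hsplit]
  calc _ ≤ ‖G - F‖ * R + ‖K θ' - K θ‖ * Q :=
        (abs_add_le _ _).trans (add_le_add
          ((abs_integral_le_norm γ _).trans (M.norm_valueDeriv_sub_le hτ hC0 hC hF hG (hn θ')))
          ((abs_integral_le_norm γ _).trans (M.norm_valueDeriv_le hτ hC0 hC hF)))
    _ ≤ L * W1 ν' ν * R + L * ‖θ' - θ‖ * R := by gcongr; exact hK θ' θ
    _ = _ := by ring

lemma isFlatDeriv_flatDeriv (hc : Continuous K) {V : Measure (Ed d) → ℝ}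
    (hV : ∀ ν, IsProbabilityMeasure ν → V ν = BM.integral γ (M.value (∫ θ, K θ ∂ν))) :
    IsFlatDeriv V (M.flatDeriv γ K) where
  growth := by
    have hn0 : 0 ≤ n := (norm_nonneg _).trans (hn 0)
    refine ⟨2 / (1 - M.discount) ^ 2
      * (C + M.temp * (2 * n + |Real.log (M.ref Set.univ).toReal|)) * n + 1, by positivity,
      fun ν θ hν => (M.abs_flatDeriv_le γ hτ hC0 hC hn hν θ).trans ?_⟩
    rw [mul_one_add]
    have : 0 ≤ (2 / (1 - M.discount) ^ 2
      * (C + M.temp * (2 * n + |Real.log (M.ref Set.univ).toReal|)) * n + 1) * ‖θ‖ := by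
      positivity
    linarith
  normalized ν hν := by
    have := hν.1
    rw [M.integral_flatDeriv γ hc hn, sub_self, map_zero, map_zero]
  firstVariation ν ν' hν hν' := by
    have := hν.1
    have := hν'.1
    rw [M.integral_flatDeriv γ hc hn ν ν', M.integral_flatDeriv γ hc hn ν ν, sub_self (∫ θ, K θ ∂ν),
      map_zero, map_zero, sub_zero]
    have h := M.hasDerivAt_value (∫ θ, K θ ∂ν) (∫ θ, K θ ∂ν' - ∫ θ, K θ ∂ν) 0
    rw [zero_smul, add_zero] at h
    have h2 := ((BM.integral γ).hasFDerivAt.comp_hasDerivAt 0 h).tendsto_slope_zero_right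
    refine h2.congr' ?_
    filter_upwards [Ioc_mem_nhdsGT (zero_lt_one' ℝ)] with ε hε
    have := isProbabilityMeasure_mix ν ν' hε.1.le hε.2
    rw [hV _ this, hV ν hν.1, integral_mix hc hn ν ν' hε.1.le hε.2, zero_add, smul_eq_mul,
      Function.comp_apply, Function.comp_apply, zero_smul, add_zero, inv_mul_eq_div]

end MeanField

end RegularizedMDP
/-- **Proposition (the regularized value function of a softmax-parametrized MDP
satisfies Assumption (A1) with explicit constants).** -/
theorem mdp_value_satisfies_A1
    {d : ℕ} {S A : Type*}
    [MeasurableSpace S] [TopologicalSpace S] [PolishSpace S] [BorelSpace S]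
    [MeasurableSpace A] [TopologicalSpace A] [PolishSpace A] [BorelSpace A]
    (P : S → A → Measure S) (hPprob : ∀ s a, IsProbabilityMeasure (P s a))
    (hPmeas : Measurable (fun p : S × A => P p.1 p.2))
    (c : S → A → ℝ) (hcmeas : Measurable (Function.uncurry c))
    (Cc : ℝ) (hCc : 0 ≤ Cc) (hc : ∀ s a, |c s a| ≤ Cc)
    (δ : ℝ) (hδ0 : 0 ≤ δ) (hδ1 : δ < 1) (τ : ℝ) (hτ : 0 < τ)
    (η : Measure A) (hηfin : IsFiniteMeasure η) (hη0 : η ≠ 0)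
    (f : Ed d → S → A → ℝ)
    (hfmeas : Measurable (fun p : Ed d × S × A => f p.1 p.2.1 p.2.2))
    (nf0 nf1 : ℝ)
    (hf0 : ∀ θ s a, |f θ s a| ≤ nf0)
    (hfdiff : ∀ s a, Differentiable ℝ (fun θ => f θ s a))
    (hf1 : ∀ θ s a, ‖fderiv ℝ (fun θ' => f θ' s a) θ‖ ≤ nf1)
    (hnf : nf0 ≤ nf1)
    (γ : Measure S) (hγ : IsProbabilityMeasure γ)
    (CF LF : ℝ)
    (hCF : CF = 2 / (1 - δ) ^ 2
        * (Cc + τ * (2 * nf0 + |Real.log ((η Set.univ).toReal)|)) * nf0)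
    (hLF : LF = nf1 *
        (1 / (1 - δ) ^ 2 * (Cc + τ * (2 * nf0 + |Real.log ((η Set.univ).toReal)|))
            * max 2 (5 / (1 - δ) * nf0)
          + 4 * τ * nf0)) :
    ∃ DV : Measure (Ed d) → Ed d → ℝ,
      IsFlatDeriv (fun ν => Vtau P c δ τ η (softmaxPolicy f η ν) γ) DV ∧
      (∀ ν θ, IsP1 ν → |DV ν θ| ≤ CF) ∧
      (∀ ν ν' θ θ', IsP1 ν → IsP1 ν' →
        |DV ν' θ' - DV ν θ| ≤ LF * (‖θ' - θ‖ + W1 ν' ν)) := by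
  obtain ⟨s₀⟩ : Nonempty S := nonempty_of_isProbabilityMeasure γ
  have : NeZero η := ⟨hη0⟩
  obtain ⟨a₀⟩ : Nonempty A := by
    by_contra h
    have := not_nonempty_iff.1 h
    exact hη0 (Measure.eq_zero_of_isEmpty η)
  have hnf0 : 0 ≤ nf0 := (abs_nonneg _).trans (hf0 0 s₀ a₀)
  have hnf1 : 0 ≤ nf1 := hnf0.trans hnf
  let κ : ProbabilityTheory.Kernel (S × A) S := ⟨fun p => P p.1 p.2, hPmeas⟩
  have : ProbabilityTheory.IsMarkovKernel κ := ⟨fun p => hPprob p.1 p.2⟩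
  let M : RegularizedMDP S A :=
    { ref := η
      next := BM.ofKernel κ
      isMarkovOp_next := BM.isMarkovOp_ofKernel κ
      cost := BM.mk (Function.uncurry c) hcmeas ⟨Cc, fun p => hc p.1 p.2⟩
      discount := δ
      discount_nonneg := hδ0
      discount_lt_one := hδ1
      temp := τ }
  let K : Ed d → BM (S × A) := fun θ =>
    BM.mk (fun p => f θ p.1 p.2) (hfmeas.comp measurable_prodMk_left)
      ⟨nf0, fun p => hf0 θ p.1 p.2⟩
  have hn (θ : Ed d) : ‖K θ‖ ≤ nf0 := BM.norm_le hnf0 fun p => hf0 θ p.1 p.2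
  have hK (θ θ' : Ed d) : ‖K θ - K θ'‖ ≤ nf1 * ‖θ - θ'‖ :=
    BM.norm_le (by positivity) fun p =>
      convex_univ.norm_image_sub_le_of_norm_fderiv_le (𝕜 := ℝ)
        (fun x _ => hfdiff p.1 p.2 x) (fun x _ => hf1 x p.1 p.2) (Set.mem_univ θ')
        (Set.mem_univ θ)
  have hc' := continuous_of_norm_sub_le hnf1 hK
  have hV (ν : Measure (Ed d)) (hν : IsProbabilityMeasure ν) :
      Vtau P c δ τ η (softmaxPolicy f η ν) γ = BM.integral γ (M.value (∫ θ, K θ ∂ν)) := by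
    have hpot (s : S) (a : A) : (∫ θ, K θ ∂ν : BM (S × A)) (s, a) = fnu f ν s a :=
      integral_apply_of_norm_le hc' hn ν (s, a)
    have hpolicy : softmaxPolicy f η ν = M.policy (∫ θ, K θ ∂ν) := by
      ext1 s
      rw [M.policy_apply, softmaxPolicy]
      simp_rw [exp_logDensity_apply, integrateAction_exp_apply, hpot]
      rfl
    rw [hpolicy]
    exact RegularizedMDP.Vtau_policy (κ := κ) (M := M) rfl _ γ
  subst hCF hLF
  exact ⟨M.flatDeriv γ K,
    M.isFlatDeriv_flatDeriv γ hτ.le hCc (fun p => hc p.1 p.2) hn hc' hV,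
    fun ν θ hν => M.abs_flatDeriv_le γ hτ.le hCc (fun p => hc p.1 p.2) hn hν θ,
    fun ν ν' θ θ' hν hν' =>
      M.abs_flatDeriv_sub_le γ hτ.le hCc (fun p => hc p.1 p.2) hn hnf1 hK hν hν' θ θ'⟩
end
end

section
/- Let S and A be Polish spaces, P a transition kernel, c : S × A → R bounded, δ ∈ [0,1), τ > 0, η a finite positive measure on A, and f ∈ 𝔠^1. For ν ∈ P_1(R^d) let Π(ν)(da|s) ∝ exp(∫ f(θ,s,a) ν(dθ)) η(da) be the softmax policy and Q_τ^{Π(ν)}(s,a) := c(s,a) + δ ∫_S V_τ^{Π(ν)}(s') P(ds'|s,a) the regularized state-action value function. Then for all ν, ν' ∈ P_1(R^d) and all (s,a) ∈ S × A: |Q_τ^{Π(ν')}(s,a) − Q_τ^{Π(ν)}(s,a)| ≤ (2δ/(1−δ)²) (|c|_∞ + τ(2|f|_{𝔠^0} + |log η(A)|)) |f|_{𝔠^1} W_1(ν',ν). -/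
open MeasureTheory Filter

noncomputable section

attribute [local instance] Classical.propDecidable

section Density

/-- The logarithmic mean of two positive numbers is at most their arithmetic mean. -/
theorem sq_sub_le_mul_log_sub_log {x y : ℝ} (hx : 0 < x) (hy : 0 < y) :
    (x - y) ^ 2 ≤ (x + y) / 2 * ((x - y) * (Real.log x - Real.log y)) := by
  wlog h : y ≤ x generalizing x y
  · linarith [this hy hx (le_of_not_ge h)]
  have h1 := Real.le_log_one_add_of_nonneg (x := (x - y) / y) (by
    apply div_nonneg <;> linarith)
  have h2 : 1 + (x - y) / y = x / y := by field_simp; ring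
  have h3 : 2 * ((x - y) / y) / ((x - y) / y + 2) = 2 * (x - y) / (x + y) := by
    have : (x - y) / y + 2 = (x + y) / y := by field_simp; ring
    rw [this]; field_simp
  rw [h2, h3, Real.log_div hx.ne' hy.ne', div_le_iff₀ (by positivity)] at h1
  nlinarith [mul_le_mul_of_nonneg_left h1 (sub_nonneg.2 h)]

variable {A : Type*} [MeasurableSpace A] {η : Measure A}

/-- `p` is a strictly positive probability density with respect to `η` whose logarithm is
bounded by `K`. -/
structure IsLogBoundedDensity (η : Measure A) (p : A → ℝ) (K : ℝ) : Prop where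
  measurable : Measurable p
  pos : ∀ a, 0 < p a
  integrable : Integrable p η
  integral_eq_one : ∫ a, p a ∂η = 1
  abs_log_le : ∀ a, |Real.log (p a)| ≤ K

namespace IsLogBoundedDensity

variable {p q : A → ℝ} {K : ℝ}

theorem integrable_mul (hp : IsLogBoundedDensity η p K) {u : A → ℝ} (hu : Measurable u)
    {C : ℝ} (hC : ∀ a, |u a| ≤ C) : Integrable (fun a => u a * p a) η :=
  hp.integrable.bdd_mul hu.aestronglyMeasurable (ae_of_all _ hC)

theorem abs_integral_mul_le (hp : IsLogBoundedDensity η p K) {u : A → ℝ} (hu : Measurable u)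
    {C : ℝ} (hC : ∀ a, |u a| ≤ C) : |∫ a, u a * p a ∂η| ≤ C := by
  calc |∫ a, u a * p a ∂η| ≤ ∫ a, |u a * p a| ∂η := abs_integral_le_integral_abs
    _ ≤ ∫ a, C * p a ∂η := by
        refine integral_mono (hp.integrable_mul hu hC).abs (hp.integrable.const_mul C) fun a => ?_
        simp only [abs_mul, abs_of_pos (hp.pos a)]
        exact mul_le_mul_of_nonneg_right (hC a) (hp.pos a).le
    _ = C := by rw [integral_const_mul, hp.integral_eq_one, mul_one]

theorem integrable_sub (hp : IsLogBoundedDensity η p K) (hq : IsLogBoundedDensity η q K) :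
    Integrable (fun a => p a - q a) η :=
  hp.integrable.sub hq.integrable

theorem integrable_mul_sub (hp : IsLogBoundedDensity η p K) (hq : IsLogBoundedDensity η q K)
    {u : A → ℝ} (hu : Measurable u) {C : ℝ} (hC : ∀ a, |u a| ≤ C) :
    Integrable (fun a => u a * (p a - q a)) η :=
  (hp.integrable_sub hq).bdd_mul hu.aestronglyMeasurable (ae_of_all _ hC)

theorem abs_integral_mul_sub_le (hp : IsLogBoundedDensity η p K)
    (hq : IsLogBoundedDensity η q K) {u : A → ℝ} (hu : Measurable u) {C : ℝ}
    (hC : ∀ a, |u a| ≤ C) :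
    |∫ a, u a * (p a - q a) ∂η| ≤ C * ∫ a, |p a - q a| ∂η := by
  calc |∫ a, u a * (p a - q a) ∂η| ≤ ∫ a, |u a * (p a - q a)| ∂η := abs_integral_le_integral_abs
    _ ≤ ∫ a, C * |p a - q a| ∂η := by
        refine integral_mono (hp.integrable_mul_sub hq hu hC).abs
          ((hp.integrable_sub hq).abs.const_mul C) fun a => ?_
        simp only [abs_mul]
        exact mul_le_mul_of_nonneg_right (hC a) (abs_nonneg _)
    _ = C * ∫ a, |p a - q a| ∂η := integral_const_mul _ _

theorem integral_sub_eq_zero (hp : IsLogBoundedDensity η p K)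
    (hq : IsLogBoundedDensity η q K) : ∫ a, (p a - q a) ∂η = 0 := by
  rw [integral_sub hp.integrable hq.integrable, hp.integral_eq_one, hq.integral_eq_one, sub_self]

theorem measurable_log_sub (hp : IsLogBoundedDensity η p K) (hq : IsLogBoundedDensity η q K) :
    Measurable fun a => Real.log (p a) - Real.log (q a) :=
  hp.measurable.log.sub hq.measurable.log

theorem abs_log_sub_le (hp : IsLogBoundedDensity η p K) (hq : IsLogBoundedDensity η q K) (a : A) :
    |Real.log (p a) - Real.log (q a)| ≤ K + K :=
  (abs_sub _ _).trans (add_le_add (hp.abs_log_le a) (hq.abs_log_le a))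

/-- The symmetrized relative entropy is controlled by the oscillation of the log-ratio. -/
theorem integral_log_sub_mul_sub_le (hp : IsLogBoundedDensity η p K)
    (hq : IsLogBoundedDensity η q K) {k ε : ℝ}
    (h : ∀ a, |Real.log (p a) - Real.log (q a) - k| ≤ ε) :
    ∫ a, (Real.log (p a) - Real.log (q a)) * (p a - q a) ∂η ≤ ε * ∫ a, |p a - q a| ∂η := by
  have hmeas := (hp.measurable_log_sub hq).sub_const k
  have : ∫ a, (Real.log (p a) - Real.log (q a)) * (p a - q a) ∂η
      = ∫ a, (Real.log (p a) - Real.log (q a) - k) * (p a - q a) ∂η := by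
    simp_rw [sub_mul _ k]
    rw [integral_sub (hp.integrable_mul_sub hq (hp.measurable_log_sub hq) (hp.abs_log_sub_le hq))
      ((hp.integrable_sub hq).const_mul k), integral_const_mul, hp.integral_sub_eq_zero hq,
      mul_zero, sub_zero]
  rw [this]
  exact (le_abs_self _).trans (hp.abs_integral_mul_sub_le hq hmeas h)

/-- If the log-ratio of two densities is within `ε` of a constant, then their `L¹` distance is at
most `ε`. -/
theorem integral_abs_sub_le (hp : IsLogBoundedDensity η p K) (hq : IsLogBoundedDensity η q K)
    {k ε : ℝ} (hε : 0 ≤ ε) (h : ∀ a, |Real.log (p a) - Real.log (q a) - k| ≤ ε) :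
    ∫ a, |p a - q a| ∂η ≤ ε := by
  have hJ := hp.integral_log_sub_mul_sub_le hq h
  have hIntJ := hp.integrable_mul_sub hq (hp.measurable_log_sub hq) (hp.abs_log_sub_le hq)
  have hadd : Integrable (fun a => p a + q a) η := hp.integrable.add hq.integrable
  set T := ∫ a, |p a - q a| ∂η with hT
  by_contra! hlt
  have hTpos : 0 < T := hε.trans_lt hlt
  have key : T ≤ ∫ a, ((T / 4) * (p a + q a)
      + 1 / (2 * T) * ((Real.log (p a) - Real.log (q a)) * (p a - q a))) ∂η := by
    refine integral_mono (hp.integrable_sub hq).abs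
      ((hadd.const_mul _).add (hIntJ.const_mul _)) fun a => ?_
    have hpa := hp.pos a
    have hqa := hq.pos a
    have hs := sq_sub_le_mul_log_sub_log hpa hqa
    simp only
    generalize Real.log (p a) - Real.log (q a) = l at *
    generalize p a = x at *
    generalize q a = y at *
    have hm : 0 < (x + y) / 2 := by positivity
    have hJ0 : 0 ≤ (x - y) * l := by
      by_contra! hneg
      nlinarith [sq_nonneg (x - y), mul_neg_of_pos_of_neg hm hneg]
    have : |x - y| ≤ Real.sqrt ((T * ((x + y) / 2)) * ((x - y) * l / T)) := by
      apply Real.abs_le_sqrt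
      refine hs.trans (le_of_eq ?_)
      field_simp
    refine this.trans ?_
    have h3 := sq_nonneg (T * ((x + y) / 2) - (x - y) * l / T)
    have h4 : T / 4 * (x + y) + 1 / (2 * T) * (l * (x - y))
      = (T * ((x + y) / 2) + (x - y) * l / T) / 2 := by field_simp; ring
    have h5 : 0 ≤ (x - y) * l / T := div_nonneg hJ0 hTpos.le
    rw [h4, Real.sqrt_le_left (by positivity)]
    nlinarith
  have hsum : ∫ a, (p a + q a) ∂η = 2 := by
    rw [integral_add hp.integrable hq.integrable, hp.integral_eq_one, hq.integral_eq_one]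
    norm_num
  rw [integral_add (hadd.const_mul _) (hIntJ.const_mul _),
    integral_const_mul, integral_const_mul, hsum] at key
  have : 1 / (2 * T) * ∫ a, (Real.log (p a) - Real.log (q a)) * (p a - q a) ∂η ≤ ε / 2 := by
    rw [div_mul_eq_mul_div, one_mul, div_le_iff₀ (by positivity)]
    linarith
  linarith

/-- Gibbs' inequality. -/
theorem integral_log_sub_mul_nonneg (hp : IsLogBoundedDensity η p K)
    (hq : IsLogBoundedDensity η q K) :
    0 ≤ ∫ a, (Real.log (p a) - Real.log (q a)) * p a ∂η := by
  rw [← hp.integral_sub_eq_zero hq]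
  refine integral_mono (hp.integrable_sub hq)
    (hp.integrable_mul (hp.measurable_log_sub hq) (hp.abs_log_sub_le hq)) fun a => ?_
  have hpa := hp.pos a
  have hqa := hq.pos a
  have h := Real.one_sub_inv_le_log_of_pos (div_pos hpa hqa)
  rw [Real.log_div hpa.ne' hqa.ne', inv_div] at h
  have h' := mul_le_mul_of_nonneg_right h hpa.le
  have : (1 - q a / p a) * p a = p a - q a := by field_simp
  simpa [this] using h'

/-- Lipschitz dependence of an entropy-regularized expectation on the density. -/
theorem abs_integral_regularized_sub_le (hp : IsLogBoundedDensity η p K)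
    (hq : IsLogBoundedDensity η q K) {k ε : ℝ} (hε : 0 ≤ ε)
    (h : ∀ a, |Real.log (p a) - Real.log (q a) - k| ≤ ε)
    {φ : A → ℝ} (hφ : Measurable φ) {Φ : ℝ} (hΦ : 0 ≤ Φ) (hφΦ : ∀ a, |φ a| ≤ Φ) {τ : ℝ}
    (hτ : 0 ≤ τ) (hK : 0 ≤ K) :
    |∫ a, (φ a + τ * Real.log (p a)) * p a ∂η - ∫ a, (φ a + τ * Real.log (q a)) * q a ∂η|
      ≤ (Φ + τ * K + τ * ε) * ε := by
  have hb : ∀ a, |φ a + τ * Real.log (q a)| ≤ Φ + τ * K := fun a =>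
    (abs_add_le _ _).trans (add_le_add (hφΦ a) (by
      rw [abs_mul, abs_of_nonneg hτ]; exact mul_le_mul_of_nonneg_left (hq.abs_log_le a) hτ))
  have hbm : Measurable fun a => φ a + τ * Real.log (q a) :=
    hφ.add (hq.measurable.log.const_mul τ)
  have hT := hp.integral_abs_sub_le hq hε h
  have hT0 : 0 ≤ ∫ a, |p a - q a| ∂η := integral_nonneg fun a => abs_nonneg _
  have h1 := hp.abs_integral_mul_sub_le hq hbm hb
  have hI1 := hp.integrable_mul_sub hq hbm hb
  have hI2 := hp.integrable_mul (hp.measurable_log_sub hq) (hp.abs_log_sub_le hq)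
  have hI3 := hq.integrable_mul hbm hb
  have hI4 := hq.integrable_mul (hp.measurable_log_sub hq) (hp.abs_log_sub_le hq)
  have hkl0 := hp.integral_log_sub_mul_nonneg hq
  have hkl1 : ∫ a, (Real.log (p a) - Real.log (q a)) * p a ∂η ≤ ε * ∫ a, |p a - q a| ∂η := by
    refine le_trans ?_ (hp.integral_log_sub_mul_sub_le hq h)
    have h2 := hq.integral_log_sub_mul_nonneg hp
    have h3 : ∫ a, (Real.log (q a) - Real.log (p a)) * q a ∂η
        = - ∫ a, (Real.log (p a) - Real.log (q a)) * q a ∂η := by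
      rw [← integral_neg]; congr 1; ext a; ring
    simp_rw [mul_sub (Real.log _ - Real.log _)]
    rw [integral_sub hI2 hI4]
    linarith
  have hsplit : ∫ a, (φ a + τ * Real.log (p a)) * p a ∂η
      = ∫ a, (φ a + τ * Real.log (q a)) * q a ∂η
        + ∫ a, (φ a + τ * Real.log (q a)) * (p a - q a) ∂η
        + τ * ∫ a, (Real.log (p a) - Real.log (q a)) * p a ∂η := by
    have hI31 : Integrable (fun a => (φ a + τ * Real.log (q a)) * q a
        + (φ a + τ * Real.log (q a)) * (p a - q a)) η := hI3.add hI1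
    rw [← integral_const_mul, ← integral_add hI3 hI1, ← integral_add hI31 (hI2.const_mul τ)]
    congr 1; ext a; ring
  rw [hsplit]
  have hA : 0 ≤ Φ + τ * K := by positivity
  have h5 := mul_le_mul_of_nonneg_left hT hA
  have h6 := mul_le_mul_of_nonneg_left (hkl1.trans (mul_le_mul_of_nonneg_left hT hε)) hτ
  have h7 := mul_nonneg hτ hkl0
  obtain ⟨h8, h9⟩ := abs_le.1 h1
  rw [abs_le]
  constructor <;> nlinarith

end IsLogBoundedDensity

/-- The density with respect to `η` of the Gibbs measure proportional to `exp g · η`. -/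
def gibbsDensity (η : Measure A) (g : A → ℝ) (a : A) : ℝ :=
  Real.exp (g a) / ∫ a', Real.exp (g a') ∂η

variable [IsFiniteMeasure η] {g : A → ℝ} {m : ℝ}

theorem integrable_exp_of_abs_le (hg : Measurable g) (hm : ∀ a, |g a| ≤ m) :
    Integrable (fun a => Real.exp (g a)) η :=
  .of_bound hg.exp.aestronglyMeasurable (Real.exp m) (ae_of_all _ fun a => by
    rw [Real.norm_eq_abs, Real.abs_exp]
    exact Real.exp_le_exp.2 ((le_abs_self _).trans (hm a)))

theorem exp_neg_mul_measure_le_integral_exp (hg : Measurable g) (hm : ∀ a, |g a| ≤ m) :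
    Real.exp (-m) * η.real Set.univ ≤ ∫ a, Real.exp (g a) ∂η := by
  have := integral_mono (μ := η) (integrable_const (Real.exp (-m)))
    (integrable_exp_of_abs_le hg hm) fun a => Real.exp_le_exp.2 (abs_le.1 (hm a)).1
  simpa [mul_comm] using this

theorem integral_exp_le_exp_mul_measure (hg : Measurable g) (hm : ∀ a, |g a| ≤ m) :
    ∫ a, Real.exp (g a) ∂η ≤ Real.exp m * η.real Set.univ := by
  have := integral_mono (μ := η) (integrable_exp_of_abs_le hg hm)
    (integrable_const (Real.exp m)) fun a => Real.exp_le_exp.2 (abs_le.1 (hm a)).2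
  simpa [mul_comm] using this

theorem integral_exp_pos_of_abs_le [NeZero η] (hg : Measurable g) (hm : ∀ a, |g a| ≤ m) :
    0 < ∫ a, Real.exp (g a) ∂η :=
  (mul_pos (Real.exp_pos _) measureReal_univ_pos).trans_le
    (exp_neg_mul_measure_le_integral_exp hg hm)

theorem abs_log_integral_exp_le [NeZero η] (hg : Measurable g) (hm : ∀ a, |g a| ≤ m) :
    |Real.log (∫ a, Real.exp (g a) ∂η)| ≤ m + |Real.log (η.real Set.univ)| := by
  have hη : 0 < η.real Set.univ := measureReal_univ_pos
  have h1 := Real.log_le_log (by positivity)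
    (exp_neg_mul_measure_le_integral_exp (η := η) hg hm)
  have h2 := Real.log_le_log (integral_exp_pos_of_abs_le hg hm)
    (integral_exp_le_exp_mul_measure (η := η) hg hm)
  rw [Real.log_mul (Real.exp_pos _).ne' hη.ne', Real.log_exp] at h1 h2
  rw [abs_le]
  constructor
  · linarith [neg_abs_le (Real.log (η.real Set.univ))]
  · linarith [le_abs_self (Real.log (η.real Set.univ))]

theorem log_gibbsDensity [NeZero η] (hg : Measurable g) (hm : ∀ a, |g a| ≤ m) (a : A) :
    Real.log (gibbsDensity η g a) = g a - Real.log (∫ a', Real.exp (g a') ∂η) := by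
  rw [gibbsDensity, Real.log_div (Real.exp_pos _).ne' (integral_exp_pos_of_abs_le hg hm).ne',
    Real.log_exp]

theorem isLogBoundedDensity_gibbsDensity [NeZero η] (hg : Measurable g)
    (hm : ∀ a, |g a| ≤ m) :
    IsLogBoundedDensity η (gibbsDensity η g) (2 * m + |Real.log (η.real Set.univ)|) where
  measurable := hg.exp.div_const _
  pos a := div_pos (Real.exp_pos _) (integral_exp_pos_of_abs_le hg hm)
  integrable := (integrable_exp_of_abs_le hg hm).div_const _
  integral_eq_one := by
    unfold gibbsDensity
    rw [integral_div, div_self (integral_exp_pos_of_abs_le hg hm).ne']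
  abs_log_le a := by
    rw [log_gibbsDensity hg hm]
    linarith [abs_sub (g a) (Real.log (∫ a', Real.exp (g a') ∂η)), hm a,
      abs_log_integral_exp_le (η := η) hg hm]

end Density

open ProbabilityTheory

section DiscountedValue

variable {S : Type*} [MeasurableSpace S] (κ : Kernel S S)

/-- The transition operator `u ↦ ∫ u(s') κ(ds'|·)` of a kernel. -/
def transitionOp (u : S → ℝ) (s : S) : ℝ := ∫ s', u s' ∂(κ s)

/-- The discounted value `Σ_n δⁿ (Tⁿ r)(s)` of a running cost `r` for the Markov chain with
transition operator `T`. -/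
def discountedValue (δ : ℝ) (r : S → ℝ) (s : S) : ℝ :=
  ∑' n : ℕ, δ ^ n * (transitionOp κ)^[n] r s

theorem integrable_of_measurable_of_abs_le {X : Type*} [MeasurableSpace X] {μ : Measure X}
    [IsFiniteMeasure μ] {u : X → ℝ} {M : ℝ} (hu : Measurable u) (hM : ∀ x, |u x| ≤ M) :
    Integrable u μ :=
  .of_bound hu.aestronglyMeasurable M (ae_of_all _ hM)

theorem abs_integral_le_of_abs_le {X : Type*} [MeasurableSpace X] {μ : Measure X}
    [IsProbabilityMeasure μ] {u : X → ℝ} {M : ℝ} (hM : ∀ x, |u x| ≤ M) : |∫ x, u x ∂μ| ≤ M := by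
  simpa using! norm_integral_le_of_norm_le_const (μ := μ) (f := u) (ae_of_all _ hM)

/-- The integral of a function against `γ κ` is the iterated integral. -/
theorem integral_bind_kernel {X : Type*} [MeasurableSpace X] {γ : Measure X} {κ : Kernel X S}
    {u : S → ℝ} (hu : Integrable u (γ.bind κ)) :
    ∫ s, u s ∂(γ.bind κ) = ∫ x, ∫ s, u s ∂(κ x) ∂γ := by
  rw [Measure.comp_eq_comp_const_apply] at hu ⊢
  rw [Kernel.integral_comp hu, Kernel.const_apply]

variable {κ} {r : S → ℝ} {M δ : ℝ}

theorem measurable_transitionOp (hr : Measurable r) : Measurable (transitionOp κ r) :=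
  hr.stronglyMeasurable.integral_kernel.measurable

theorem measurable_transitionOp_iterate (hr : Measurable r) (n : ℕ) :
    Measurable ((transitionOp κ)^[n] r) := by
  induction n with
  | zero => exact hr
  | succ n ih =>
    rw [Function.iterate_succ_apply']
    exact measurable_transitionOp ih

variable [IsMarkovKernel κ]

theorem abs_transitionOp_iterate_le (hM : ∀ s, |r s| ≤ M) (n : ℕ) (s : S) :
    |(transitionOp κ)^[n] r s| ≤ M := by
  induction n generalizing s with
  | zero => exact hM s
  | succ n ih =>
    rw [Function.iterate_succ_apply']
    exact abs_integral_le_of_abs_le ih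

theorem integral_bind_iterate (γ : Measure S) [IsProbabilityMeasure γ] (n : ℕ) {u : S → ℝ}
    (hu : Measurable u) (hM : ∀ s, |u s| ≤ M) :
    ∫ s, u s ∂((fun γ : Measure S => γ.bind κ)^[n] γ) = ∫ s, (transitionOp κ)^[n] u s ∂γ := by
  induction n generalizing γ with
  | zero => rfl
  | succ n ih =>
    rw [Function.iterate_succ_apply, Function.iterate_succ_apply', ih (γ.bind κ)]
    exact integral_bind_kernel (integrable_of_measurable_of_abs_le
      (measurable_transitionOp_iterate hu n) (abs_transitionOp_iterate_le hM n))

theorem abs_pow_mul_transitionOp_iterate_le (hδ0 : 0 ≤ δ) (hM : ∀ s, |r s| ≤ M) (n : ℕ) (s : S) :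
    |δ ^ n * (transitionOp κ)^[n] r s| ≤ δ ^ n * M := by
  rw [abs_mul, abs_of_nonneg (pow_nonneg hδ0 n)]
  exact mul_le_mul_of_nonneg_left (abs_transitionOp_iterate_le hM n s) (pow_nonneg hδ0 n)

theorem summable_discountedValue (hδ0 : 0 ≤ δ) (hδ1 : δ < 1) (hM : ∀ s, |r s| ≤ M) (s : S) :
    Summable fun n : ℕ => δ ^ n * (transitionOp κ)^[n] r s :=
  .of_norm_bounded ((summable_geometric_of_lt_one hδ0 hδ1).mul_right M)
    fun n => (Real.norm_eq_abs _).trans_le (abs_pow_mul_transitionOp_iterate_le hδ0 hM n s)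

theorem abs_discountedValue_le (hδ0 : 0 ≤ δ) (hδ1 : δ < 1) (hM : ∀ s, |r s| ≤ M) (s : S) :
    |discountedValue κ δ r s| ≤ M / (1 - δ) := by
  have h := (hasSum_geometric_of_lt_one hδ0 hδ1).mul_right M
  rw [inv_mul_eq_div] at h
  exact tsum_of_norm_bounded (f := fun n => δ ^ n * (transitionOp κ)^[n] r s) h
    fun n => abs_pow_mul_transitionOp_iterate_le hδ0 hM n s

theorem measurable_discountedValue (hδ0 : 0 ≤ δ) (hδ1 : δ < 1) (hr : Measurable r)
    (hM : ∀ s, |r s| ≤ M) : Measurable (discountedValue κ δ r) := by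
  refine measurable_of_tendsto_metrizable
    (f := fun N s => ∑ n ∈ Finset.range N, δ ^ n * (transitionOp κ)^[n] r s)
    (fun N => Finset.measurable_sum _ fun n _ =>
      (measurable_transitionOp_iterate hr n).const_mul _) ?_
  rw [tendsto_pi_nhds]
  exact fun s => (summable_discountedValue hδ0 hδ1 hM s).hasSum.tendsto_sum_nat

/-- The Bellman equation for the discounted value. -/
theorem discountedValue_eq (hδ0 : 0 ≤ δ) (hδ1 : δ < 1) (hr : Measurable r)
    (hM : ∀ s, |r s| ≤ M) (s : S) :
    discountedValue κ δ r s = r s + δ * ∫ s', discountedValue κ δ r s' ∂(κ s) := by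
  have hmeas := fun n => (measurable_transitionOp_iterate (κ := κ) hr n).const_mul (δ ^ n)
  have hint : ∀ n, Integrable (fun s' => δ ^ n * (transitionOp κ)^[n] r s') (κ s) := fun n =>
    integrable_of_measurable_of_abs_le (hmeas n)
      (abs_pow_mul_transitionOp_iterate_le hδ0 hM n)
  have hsum : Summable fun n => ∫ s', ‖δ ^ n * (transitionOp κ)^[n] r s'‖ ∂(κ s) := by
    refine .of_nonneg_of_le (fun n => integral_nonneg fun _ => norm_nonneg _) (fun n => ?_)
      ((summable_geometric_of_lt_one hδ0 hδ1).mul_right M)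
    refine (le_abs_self _).trans (abs_integral_le_of_abs_le fun s' => ?_)
    rw [abs_norm]
    exact abs_pow_mul_transitionOp_iterate_le hδ0 hM n s'
  have hswap := integral_tsum_of_summable_integral_norm hint hsum
  unfold discountedValue
  rw [(summable_discountedValue hδ0 hδ1 hM s).tsum_eq_zero_add, ← hswap, ← tsum_mul_left]
  simp only [pow_zero, one_mul, Function.iterate_zero, id_eq, Function.iterate_succ_apply']
  congr 1
  refine tsum_congr fun n => ?_
  rw [integral_const_mul, pow_succ', mul_assoc]
  rfl

end DiscountedValue

section SoftmaxMDP

section Policy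

variable {S A : Type*} [MeasurableSpace A]

/-- The policy with density `p(s,·)` with respect to `η`. -/
def densityPolicy (η : Measure A) (p : S → A → ℝ) (s : S) : Measure A :=
  η.withDensity fun a => ENNReal.ofReal (p s a)

variable {η : Measure A} {p : S → A → ℝ} {K : ℝ}

theorem integral_densityPolicy (hp : ∀ s, IsLogBoundedDensity η (p s) K) (s : S) (u : A → ℝ) :
    ∫ a, u a ∂(densityPolicy η p s) = ∫ a, u a * p s a ∂η := by
  unfold densityPolicy
  rw [integral_withDensity_eq_integral_toReal_smul (hp s).measurable.ennreal_ofReal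
    (ae_of_all _ fun a => ENNReal.ofReal_lt_top)]
  refine integral_congr_ae (ae_of_all _ fun a => ?_)
  simp [ENNReal.toReal_ofReal ((hp s).pos a).le, mul_comm]

theorem isProbabilityMeasure_densityPolicy (hp : ∀ s, IsLogBoundedDensity η (p s) K) (s : S) :
    IsProbabilityMeasure (densityPolicy η p s) := by
  constructor
  rw [densityPolicy, withDensity_apply _ MeasurableSet.univ, Measure.restrict_univ,
    ← ofReal_integral_eq_lintegral_ofReal (hp s).integrable (ae_of_all _ fun a => ((hp s).pos a).le),
    (hp s).integral_eq_one, ENNReal.ofReal_one]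

theorem runCost_densityPolicy [IsFiniteMeasure η]
    (hp : ∀ s, IsLogBoundedDensity η (p s) K)
    (c : S → A → ℝ) (τ : ℝ) (s : S) :
    runCost c τ η (densityPolicy η p) s
      = ∫ a, (c s a + τ * Real.log (p s a)) ∂(densityPolicy η p s) := by
  refine integral_congr_ae ?_
  have h := Measure.rnDeriv_withDensity η (hp s).measurable.ennreal_ofReal
  filter_upwards [(withDensity_absolutelyContinuous η _).ae_le h] with a ha
  have ha' : (densityPolicy η p s).rnDeriv η a = ENNReal.ofReal (p s a) := ha
  rw [ha', ENNReal.toReal_ofReal ((hp s).pos a).le]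

end Policy

variable {S A : Type*} [MeasurableSpace S] [MeasurableSpace A]

/-- The policy with density `p` as a Markov kernel. -/
def densityKernel (η : Measure A) [IsFiniteMeasure η] (p : S → A → ℝ)
    (hpm : Measurable (Function.uncurry p)) : Kernel S A where
  toFun := densityPolicy η p
  measurable' := by
    refine Measure.measurable_of_measurable_coe _ fun B hB => ?_
    simp only [densityPolicy, withDensity_apply _ hB]
    exact Measurable.lintegral_prod_right' (f := fun x : S × A => ENNReal.ofReal (p x.1 x.2))
      hpm.ennreal_ofReal

/-- The state transition kernel induced by a policy. -/
def stateKernel (P : Kernel (S × A) S) (π : Kernel S A) [IsSFiniteKernel π] : Kernel S S where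
  toFun s := (π s).bind fun a => P (s, a)
  measurable' := by
    refine Measure.measurable_of_measurable_coe _ fun B hB => ?_
    have h : ∀ s, ((π s).bind fun a => P (s, a)) B = ∫⁻ a, P (s, a) B ∂(π s) := fun s =>
      Measure.bind_apply hB (P.measurable.comp measurable_prodMk_left).aemeasurable
    simp only [h]
    exact Measurable.lintegral_kernel_prod_right' (f := fun x : S × A => P x B)
      (P.measurable_coe hB)

theorem isMarkovKernel_stateKernel (P : Kernel (S × A) S) [IsMarkovKernel P] (π : Kernel S A)
    [IsMarkovKernel π] : IsMarkovKernel (stateKernel P π) := by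
  refine ⟨fun s => ⟨?_⟩⟩
  change ((π s).bind fun a => P (s, a)) Set.univ = 1
  have h : Measurable fun a => P (s, a) := P.measurable.comp measurable_prodMk_left
  rw [Measure.bind_apply MeasurableSet.univ h.aemeasurable]
  simp

theorem integral_stateKernel (P : Kernel (S × A) S) [IsMarkovKernel P] (π : Kernel S A)
    [IsMarkovKernel π] {u : S → ℝ} {M : ℝ} (hu : Measurable u) (hM : ∀ s, |u s| ≤ M) (s : S) :
    ∫ s', u s' ∂(stateKernel P π s) = ∫ a, ∫ s', u s' ∂(P (s, a)) ∂(π s) := by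
  have := isMarkovKernel_stateKernel P π
  have hint : Integrable u (stateKernel P π s) := integrable_of_measurable_of_abs_le hu hM
  exact integral_bind_kernel (κ := P.comap (fun a => (s, a)) measurable_prodMk_left) hint

/-- The properties of the regularized value function of a policy with log-bounded density:
measurability, boundedness, and the Bellman equation. -/
theorem Vtau_densityPolicy (P : Kernel (S × A) S) [IsMarkovKernel P] {c : S → A → ℝ}
    (hcm : Measurable (Function.uncurry c)) {Cc : ℝ} (hc : ∀ s a, |c s a| ≤ Cc)
    {δ : ℝ} (hδ0 : 0 ≤ δ) (hδ1 : δ < 1) {τ : ℝ} (hτ : 0 ≤ τ) {η : Measure A} [IsFiniteMeasure η]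
    {p : S → A → ℝ} {K : ℝ} (hpm : Measurable (Function.uncurry p))
    (hp : ∀ s, IsLogBoundedDensity η (p s) K) :
    let V := fun s => Vtau (fun s a => P (s, a)) c δ τ η (densityPolicy η p) (Measure.dirac s)
    Measurable V ∧ (∀ s, |V s| ≤ (Cc + τ * K) / (1 - δ)) ∧
      ∀ s, V s = ∫ a, (c s a + δ * ∫ s', V s' ∂(P (s, a)) + τ * Real.log (p s a)) * p s a ∂η := by
  intro V
  let π := densityKernel η p hpm
  have hπ : IsMarkovKernel π := ⟨isProbabilityMeasure_densityPolicy hp⟩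
  let κ := stateKernel P π
  have hκ : IsMarkovKernel κ := isMarkovKernel_stateKernel P π
  let r := runCost c τ η (densityPolicy η p)
  have hcost : ∀ s a, |c s a + τ * Real.log (p s a)| ≤ Cc + τ * K := fun s a =>
    (abs_add_le _ _).trans (add_le_add (hc s a) (by
      rw [abs_mul, abs_of_nonneg hτ]
      exact mul_le_mul_of_nonneg_left ((hp s).abs_log_le a) hτ))
  have hr_eq : ∀ s, r s = ∫ a, (c s a + τ * Real.log (p s a)) ∂(π s) :=
    runCost_densityPolicy hp c τ
  have hcostm : Measurable fun x : S × A => c x.1 x.2 + τ * Real.log (p x.1 x.2) :=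
    Measurable.add hcm (hpm.log.const_mul τ)
  have hrm : Measurable r := by
    rw [funext hr_eq]
    exact hcostm.stronglyMeasurable.integral_kernel_prod_right'.measurable
  have hrM : ∀ s, |r s| ≤ Cc + τ * K := fun s => by
    rw [hr_eq]
    exact abs_integral_le_of_abs_le (hcost s)
  have hV : V = discountedValue κ δ r := by
    funext s
    refine tsum_congr fun n => ?_
    congr 1
    exact (integral_bind_iterate (κ := κ) (Measure.dirac s) n hrm hrM).trans
      (integral_dirac' _ _ (measurable_transitionOp_iterate hrm n).stronglyMeasurable)
  have hVm : Measurable V := hV ▸ measurable_discountedValue hδ0 hδ1 hrm hrM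
  have hVb : ∀ s, |V s| ≤ (Cc + τ * K) / (1 - δ) := hV ▸ abs_discountedValue_le hδ0 hδ1 hrM
  refine ⟨hVm, hVb, fun s => ?_⟩
  have hPVm : Measurable fun a => ∫ s', V s' ∂(P (s, a)) :=
    (hVm.stronglyMeasurable.integral_kernel (κ := P)).measurable.comp measurable_prodMk_left
  have hbell : V s = r s + δ * ∫ s', V s' ∂(κ s) := by
    rw [hV]; exact discountedValue_eq hδ0 hδ1 hrm hrM s
  have hi1 : Integrable (fun a => c s a + τ * Real.log (p s a)) (π s) :=
    integrable_of_measurable_of_abs_le (hcostm.comp measurable_prodMk_left) (hcost s)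
  have hi2 : Integrable (fun a => δ * ∫ s', V s' ∂(P (s, a))) (π s) :=
    (integrable_of_measurable_of_abs_le hPVm fun a => abs_integral_le_of_abs_le hVb).const_mul δ
  rw [hbell, integral_stateKernel P π hVm hVb, hr_eq, ← integral_const_mul, ← integral_add hi1 hi2]
  refine (integral_densityPolicy hp s _).trans ?_
  congr 1; ext a; ring

/-- Lipschitz dependence of the regularized value function on the log-density of the policy. -/
theorem abs_Vtau_densityPolicy_sub_le (P : Kernel (S × A) S) [IsMarkovKernel P] {c : S → A → ℝ}
    (hcm : Measurable (Function.uncurry c)) {Cc : ℝ} (hCc : 0 ≤ Cc) (hc : ∀ s a, |c s a| ≤ Cc)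
    {δ : ℝ} (hδ0 : 0 ≤ δ) (hδ1 : δ < 1) {τ : ℝ} (hτ : 0 ≤ τ) {η : Measure A} [IsFiniteMeasure η]
    {p q : S → A → ℝ} {K : ℝ} (hK : 0 ≤ K) (hpm : Measurable (Function.uncurry p))
    (hp : ∀ s, IsLogBoundedDensity η (p s) K) (hqm : Measurable (Function.uncurry q))
    (hq : ∀ s, IsLogBoundedDensity η (q s) K) {k : S → ℝ} {ε : ℝ} (hε : 0 ≤ ε) (hεK : ε ≤ K)
    (h : ∀ s a, |Real.log (p s a) - Real.log (q s a) - k s| ≤ ε) (s : S) :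
    |Vtau (fun s a => P (s, a)) c δ τ η (densityPolicy η p) (Measure.dirac s)
        - Vtau (fun s a => P (s, a)) c δ τ η (densityPolicy η q) (Measure.dirac s)|
      ≤ 2 * (Cc + τ * K) * ε / (1 - δ) ^ 2 := by
  obtain ⟨hVm, hVb, hV⟩ := Vtau_densityPolicy P hcm hc hδ0 hδ1 hτ hpm hp
  obtain ⟨hWm, hWb, hW⟩ := Vtau_densityPolicy P hcm hc hδ0 hδ1 hτ hqm hq
  set V := fun s => Vtau (fun s a => P (s, a)) c δ τ η (densityPolicy η p) (Measure.dirac s)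
  set W := fun s => Vtau (fun s a => P (s, a)) c δ τ η (densityPolicy η q) (Measure.dirac s)
  change |V s - W s| ≤ _
  have hδ : 0 < 1 - δ := sub_pos.2 hδ1
  set M := Cc + τ * K with hM
  have hτK : 0 ≤ τ * K := mul_nonneg hτ hK
  have hM0 : 0 ≤ M := add_nonneg hCc hτK
  have hbdd : BddAbove (Set.range fun s => |V s - W s|) :=
    ⟨M / (1 - δ) + M / (1 - δ), by
      rintro _ ⟨s, rfl⟩
      exact (abs_sub _ _).trans (add_le_add (hVb s) (hWb s))⟩
  set D := ⨆ s, |V s - W s|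
  have hD : ∀ s, |V s - W s| ≤ D := le_ciSup hbdd
  have hstep : ∀ s, |V s - W s| ≤ 2 * M / (1 - δ) * ε + δ * D := by
    intro s
    have hPm : ∀ {U : S → ℝ}, Measurable U → Measurable fun a => ∫ s', U s' ∂(P (s, a)) :=
      fun hU =>
        (hU.stronglyMeasurable.integral_kernel (κ := P)).measurable.comp measurable_prodMk_left
    have hcms : Measurable (c s) := hcm.comp measurable_prodMk_left
    have hφm : Measurable fun a => c s a + δ * ∫ s', W s' ∂(P (s, a)) :=
      hcms.add ((hPm hWm).const_mul δ)
    have hφb : ∀ a, |c s a + δ * ∫ s', W s' ∂(P (s, a))| ≤ Cc + δ * (M / (1 - δ)) := fun a =>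
      (abs_add_le _ _).trans (add_le_add (hc s a) (by
        rw [abs_mul, abs_of_nonneg hδ0]
        exact mul_le_mul_of_nonneg_left (abs_integral_le_of_abs_le hWb) hδ0))
    have h1 := (hp s).abs_integral_regularized_sub_le (hq s) hε (h s) hφm (by positivity) hφb
      hτ hK
    have hub : ∀ a, |∫ s', (V s' - W s') ∂(P (s, a))| ≤ D := fun a =>
      abs_integral_le_of_abs_le hD
    have h2 := (hp s).abs_integral_mul_le (hPm (hVm.sub hWm)) hub
    have hdiff : ∀ a, ∫ s', (V s' - W s') ∂(P (s, a))
        = ∫ s', V s' ∂(P (s, a)) - ∫ s', W s' ∂(P (s, a)) := fun a =>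
      integral_sub (integrable_of_measurable_of_abs_le hVm hVb)
        (integrable_of_measurable_of_abs_le hWm hWb)
    have hJ1 : Integrable
        (fun a => (c s a + δ * ∫ s', W s' ∂(P (s, a)) + τ * Real.log (p s a)) * p s a) η := by
      refine (hp s).integrable_mul (hφm.add ((hp s).measurable.log.const_mul τ))
        (C := Cc + δ * (M / (1 - δ)) + τ * K) fun a => ?_
      refine (abs_add_le _ _).trans (add_le_add (hφb a) ?_)
      rw [abs_mul, abs_of_nonneg hτ]
      exact mul_le_mul_of_nonneg_left ((hp s).abs_log_le a) hτ
    have hJ2 : Integrable (fun a => δ * ((∫ s', (V s' - W s') ∂(P (s, a))) * p s a)) η :=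
      ((hp s).integrable_mul (hPm (hVm.sub hWm)) hub).const_mul δ
    have h3 : V s = ∫ a, (c s a + δ * ∫ s', W s' ∂(P (s, a)) + τ * Real.log (p s a)) * p s a ∂η
        + δ * ∫ a, (∫ s', (V s' - W s') ∂(P (s, a))) * p s a ∂η := by
      rw [hV s, ← integral_const_mul, ← integral_add hJ1 hJ2]
      congr 1; ext a; rw [hdiff]; ring
    have h4 : Cc + δ * (M / (1 - δ)) + τ * K + τ * ε ≤ 2 * M / (1 - δ) := by
      have e1 : Cc + δ * (M / (1 - δ)) + τ * K = M / (1 - δ) := by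
        rw [hM]; field_simp; ring
      have e2 : τ * ε ≤ M := by nlinarith
      have e3 : M ≤ M / (1 - δ) := by
        rw [le_div_iff₀ hδ]; nlinarith
      rw [e1, mul_div_assoc]; linarith
    have h5 := mul_le_mul_of_nonneg_right h4 hε
    have h6 := mul_le_mul_of_nonneg_left h2 hδ0
    rw [← abs_of_nonneg hδ0, ← abs_mul, abs_of_nonneg hδ0] at h6
    rw [h3, hW s, add_sub_right_comm]
    exact (abs_add_le _ _).trans (add_le_add (h1.trans h5) h6)
  have : Nonempty S := ⟨s⟩
  have hfix : D ≤ 2 * M / (1 - δ) * ε + δ * D := ciSup_le hstep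
  have hDle : D ≤ 2 * M * ε / (1 - δ) ^ 2 := by
    rw [le_div_iff₀ (by positivity)]
    have e : 2 * M / (1 - δ) * ε * (1 - δ) = 2 * M * ε := by field_simp
    nlinarith
  exact (hD s).trans hDle

end SoftmaxMDP

section Wasserstein

variable {d : ℕ}

theorem integrable_of_lipschitzWith_one {ν : Measure (Ed d)} (hν : IsP1 ν) {L : Ed d → ℝ}
    (hL : LipschitzWith 1 L) : Integrable (fun x => L x - L 0) ν := by
  refine hν.2.mono' (hL.continuous.sub continuous_const).aestronglyMeasurable
    (ae_of_all _ fun x => ?_)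
  simpa [dist_eq_norm] using hL.dist_le_mul x 0

theorem bddAbove_range_integral_sub {ν ν' : Measure (Ed d)} (hν : IsP1 ν) (hν' : IsP1 ν') :
    BddAbove (Set.range fun L : {L : Ed d → ℝ // LipschitzWith 1 L} =>
      ∫ x, L.1 x ∂ν - ∫ x, L.1 x ∂ν') := by
  have hcenter : ∀ {ρ : Measure (Ed d)}, IsP1 ρ → ∀ L : Ed d → ℝ, LipschitzWith 1 L →
      |∫ x, L x ∂ρ - L 0| ≤ ∫ x, ‖x‖ ∂ρ := by
    intro ρ hρ L hL
    have := hρ.1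
    have hint := integrable_of_lipschitzWith_one hρ hL
    have hLint : Integrable L ρ :=
      (hint.add (integrable_const (L 0))).congr (ae_of_all _ fun x => sub_add_cancel _ _)
    have heq : ∫ x, L x ∂ρ - L 0 = ∫ x, (L x - L 0) ∂ρ := by
      rw [integral_sub hLint (integrable_const _)]; simp
    rw [heq]
    refine abs_integral_le_integral_abs.trans (integral_mono hint.abs hρ.2 fun x => ?_)
    simpa [dist_eq_norm] using hL.dist_le_mul x 0
  refine ⟨∫ x, ‖x‖ ∂ν + ∫ x, ‖x‖ ∂ν', ?_⟩
  rintro _ ⟨L, rfl⟩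
  have h1 := abs_le.1 (hcenter hν L.1 L.2)
  have h2 := abs_le.1 (hcenter hν' L.1 L.2)
  simp only
  linarith [h1.2, h2.1]

/-- Kantorovich–Rubinstein bound for a `C`-Lipschitz function. -/
theorem abs_integral_sub_le_mul_W1_s17 {ν ν' : Measure (Ed d)} (hν : IsP1 ν) (hν' : IsP1 ν')
    {u : Ed d → ℝ} {C : NNReal} (hC : 0 < C) (hu : LipschitzWith C u) :
    |∫ x, u x ∂ν - ∫ x, u x ∂ν'| ≤ C * W1 ν ν' := by
  have key : ∀ w : Ed d → ℝ, LipschitzWith C w →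
      ∫ x, w x ∂ν - ∫ x, w x ∂ν' ≤ C * W1 ν ν' := by
    intro w hw
    have hC' : (0 : ℝ) < C := hC
    have hL : LipschitzWith 1 fun x => (C : ℝ)⁻¹ * w x := by
      refine LipschitzWith.of_dist_le_mul fun x y => ?_
      rw [Real.dist_eq, ← mul_sub, abs_mul, abs_of_pos (inv_pos.2 hC'), NNReal.coe_one, one_mul,
        inv_mul_le_iff₀ hC', ← Real.dist_eq]
      exact hw.dist_le_mul x y
    have h : ∫ x, (C : ℝ)⁻¹ * w x ∂ν - ∫ x, (C : ℝ)⁻¹ * w x ∂ν' ≤ W1 ν ν' :=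
      le_ciSup (bddAbove_range_integral_sub hν hν') ⟨_, hL⟩
    rwa [integral_const_mul, integral_const_mul, ← mul_sub, inv_mul_le_iff₀ hC'] at h
  refine abs_le.2 ⟨?_, key u hu⟩
  have := key (fun x => -u x) hu.neg
  rw [integral_neg, integral_neg] at this
  linarith

end Wasserstein

/-- **Lemma (Lipschitz continuity of the regularized state-action value function in the
network parameter measure).** -/
theorem mdp_Q_lipschitz
    {d : ℕ} {S A : Type*}
    [MeasurableSpace S] [TopologicalSpace S] [PolishSpace S] [BorelSpace S]
    [MeasurableSpace A] [TopologicalSpace A] [PolishSpace A] [BorelSpace A]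
    (P : S → A → Measure S) (hPprob : ∀ s a, IsProbabilityMeasure (P s a))
    (hPmeas : Measurable (fun p : S × A => P p.1 p.2))
    (c : S → A → ℝ) (hcmeas : Measurable (Function.uncurry c))
    (Cc : ℝ) (hCc : 0 ≤ Cc) (hc : ∀ s a, |c s a| ≤ Cc)
    (δ : ℝ) (hδ0 : 0 ≤ δ) (hδ1 : δ < 1) (τ : ℝ) (hτ : 0 < τ)
    (η : Measure A) (hηfin : IsFiniteMeasure η) (hη0 : η ≠ 0)
    (f : Ed d → S → A → ℝ)
    (hfmeas : Measurable (fun p : Ed d × S × A => f p.1 p.2.1 p.2.2))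
    (nf0 nf1 : ℝ)
    (hf0 : ∀ θ s a, |f θ s a| ≤ nf0)
    (hfdiff : ∀ s a, Differentiable ℝ (fun θ => f θ s a))
    (hf1 : ∀ θ s a, ‖fderiv ℝ (fun θ' => f θ' s a) θ‖ ≤ nf1)
    (hnf : nf0 ≤ nf1) :
    ∀ ν ν', IsP1 ν → IsP1 ν' → ∀ s a,
      |Qtau P c δ τ η (softmaxPolicy f η ν') s a
          - Qtau P c δ τ η (softmaxPolicy f η ν) s a| ≤
        2 * δ / (1 - δ) ^ 2
          * (Cc + τ * (2 * nf0 + |Real.log ((η Set.univ).toReal)|)) * nf1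
          * W1 ν' ν := by
  intro ν ν' hν hν' s a
  have := hν.1
  have := hν'.1
  have hη : NeZero η := ⟨hη0⟩
  let Pk : Kernel (S × A) S := ⟨fun x => P x.1 x.2, hPmeas⟩
  have hPk : IsMarkovKernel Pk := ⟨fun x => hPprob x.1 x.2⟩
  have hnf0 : 0 ≤ nf0 := (abs_nonneg _).trans (hf0 0 s a)
  have hnf1 : 0 ≤ nf1 := hnf0.trans hnf
  have hlip : ∀ s a, |fnu f ν' s a - fnu f ν s a| ≤ nf1 * W1 ν' ν := by
    intro s a
    rcases hnf1.eq_or_lt with h | h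
    · have hz : ∀ θ s a, f θ s a = 0 := fun θ s a =>
        abs_nonpos_iff.1 ((hf0 θ s a).trans (hnf.trans h.ge))
      simp [fnu, hz, ← h]
    · lift nf1 to NNReal using hnf1
      exact abs_integral_sub_le_mul_W1_s17 hν' hν h
        (lipschitzWith_of_nnnorm_fderiv_le (hfdiff s a) fun θ => hf1 θ s a)
  have hgb : ∀ {ρ : Measure (Ed d)}, IsProbabilityMeasure ρ → ∀ s a, |fnu f ρ s a| ≤ nf0 :=
    fun _ s a => abs_integral_le_of_abs_le fun θ => hf0 θ s a
  have hgm : ∀ {ρ : Measure (Ed d)}, IsProbabilityMeasure ρ →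
      Measurable fun x : S × A => fnu f ρ x.1 x.2 := fun _ =>
    (hfmeas.comp measurable_swap).stronglyMeasurable.integral_prod_right'.measurable
  have hgms : ∀ {ρ : Measure (Ed d)}, IsProbabilityMeasure ρ → ∀ s, Measurable (fnu f ρ s) :=
    fun hρ s => (hgm hρ).comp measurable_prodMk_left
  have hp : ∀ {ρ : Measure (Ed d)}, IsProbabilityMeasure ρ → ∀ s,
      IsLogBoundedDensity η (gibbsDensity η (fnu f ρ s))
        (2 * nf0 + |Real.log (η.real Set.univ)|) := fun hρ s =>
    isLogBoundedDensity_gibbsDensity (hgms hρ s) (hgb hρ s)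
  have hpm : ∀ {ρ : Measure (Ed d)}, IsProbabilityMeasure ρ →
      Measurable (Function.uncurry fun s => gibbsDensity η (fnu f ρ s)) := fun hρ =>
    (hgm hρ).exp.div
      ((hgm hρ).exp.stronglyMeasurable.integral_prod_right'.measurable.comp measurable_fst)
  have hε0 : 0 ≤ min (nf1 * W1 ν' ν) (2 * nf0) :=
    le_min ((abs_nonneg _).trans (hlip s a)) (by positivity)
  have hratio : ∀ s a, |Real.log (gibbsDensity η (fnu f ν' s) a)
      - Real.log (gibbsDensity η (fnu f ν s) a)
      - (Real.log (∫ a', Real.exp (fnu f ν s a') ∂η)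
        - Real.log (∫ a', Real.exp (fnu f ν' s a') ∂η))| ≤ min (nf1 * W1 ν' ν) (2 * nf0) := by
    intro s a
    rw [log_gibbsDensity (hgms hν.1 s) (hgb hν.1 s), log_gibbsDensity (hgms hν'.1 s) (hgb hν'.1 s)]
    have e : ∀ x x' l l' : ℝ, x' - l' - (x - l) - (l - l') = x' - x := fun _ _ _ _ => by ring
    rw [e]
    refine le_min (hlip s a) ?_
    linarith [abs_sub (fnu f ν' s a) (fnu f ν s a), hgb hν.1 s a, hgb hν'.1 s a]
  have hV := abs_Vtau_densityPolicy_sub_le Pk hcmeas hCc hc hδ0 hδ1 hτ.le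
    (K := 2 * nf0 + |Real.log (η.real Set.univ)|) (by positivity) (hpm hν'.1) (hp hν'.1)
    (hpm hν.1) (hp hν.1) hε0
    ((min_le_right _ _).trans (le_add_of_nonneg_right (abs_nonneg _))) hratio
  obtain ⟨hm, hb, -⟩ := Vtau_densityPolicy Pk hcmeas hc hδ0 hδ1 hτ.le (hpm hν.1) (hp hν.1)
  obtain ⟨hm', hb', -⟩ := Vtau_densityPolicy Pk hcmeas hc hδ0 hδ1 hτ.le (hpm hν'.1) (hp hν'.1)
  have hQ : Qtau P c δ τ η (softmaxPolicy f η ν') s a - Qtau P c δ τ η (softmaxPolicy f η ν) s a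
      = δ * ∫ s', (Vtau P c δ τ η (softmaxPolicy f η ν') (Measure.dirac s')
        - Vtau P c δ τ η (softmaxPolicy f η ν) (Measure.dirac s')) ∂(P s a) := by
    have := hPprob s a
    have hI' : Integrable
        (fun s' => Vtau P c δ τ η (softmaxPolicy f η ν') (Measure.dirac s')) (P s a) :=
      integrable_of_measurable_of_abs_le hm' hb'
    have hI : Integrable
        (fun s' => Vtau P c δ τ η (softmaxPolicy f η ν) (Measure.dirac s')) (P s a) :=
      integrable_of_measurable_of_abs_le hm hb
    rw [integral_sub hI' hI]
    simp only [Qtau]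
    ring
  rw [hQ, abs_mul, abs_of_nonneg hδ0]
  have := hPprob s a
  refine (mul_le_mul_of_nonneg_left (abs_integral_le_of_abs_le hV) hδ0).trans ?_
  have hM : 0 ≤ 2 * δ / (1 - δ) ^ 2
      * (Cc + τ * (2 * nf0 + |Real.log (η.real Set.univ)|)) := by positivity
  have h := mul_le_mul_of_nonneg_left (min_le_left (nf1 * W1 ν' ν) (2 * nf0)) hM
  calc _ = 2 * δ / (1 - δ) ^ 2 * (Cc + τ * (2 * nf0 + |Real.log (η.real Set.univ)|))
        * min (nf1 * W1 ν' ν) (2 * nf0) := by ring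
    _ ≤ _ := h
    _ = _ := by rw [Measure.real, mul_assoc _ nf1]
end
end

section
/- Let S and A be Polish spaces, η a finite positive measure on A, and f ∈ 𝔠^1 (bounded, measurable, differentiable in θ with |f|_{𝔠^1} < ∞). For ν ∈ P_1(R^d), let Π(ν)(da|s) := exp(∫ f(θ,s,a) ν(dθ)) η(da) / ∫_A exp(∫ f(θ,s,a') ν(dθ)) η(da') be the softmax policy. Then for all ν, ν' ∈ P_1(R^d), all s ∈ S and η-almost all a ∈ A: |log(dΠ(ν')/dη)(a|s) − log(dΠ(ν)/dη)(a|s)| ≤ 2 |f|_{𝔠^1} W_1(ν', ν). -/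
open MeasureTheory Filter

noncomputable section

attribute [local instance] Classical.propDecidable

theorem LipschitzWith.integrable_of_integrable_norm {E : Type*} [NormedAddCommGroup E]
    [MeasurableSpace E] [OpensMeasurableSpace E] {μ : Measure E} [IsFiniteMeasure μ]
    {K : NNReal} {g : E → ℝ} (hg : LipschitzWith K g) (hμ : Integrable (fun x => ‖x‖) μ) :
    Integrable g μ := by
  refine ((integrable_const ‖g 0‖).add (hμ.const_mul (K : ℝ))).mono'
    hg.continuous.measurable.aestronglyMeasurable (Eventually.of_forall fun x => ?_)
  have h := hg.norm_sub_le x 0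
  rw [sub_zero] at h
  calc ‖g x‖ = ‖g 0 + (g x - g 0)‖ := by rw [add_sub_cancel]
    _ ≤ ‖g 0‖ + ‖g x - g 0‖ := norm_add_le _ _
    _ ≤ ‖g 0‖ + K * ‖x‖ := by gcongr

theorem integral_sub_integral_le_of_lipschitzWith_one {d : ℕ} {μ ν : Measure (Ed d)}
    (hμ : IsP1 μ) (hν : IsP1 ν) {g : Ed d → ℝ} (hg : LipschitzWith 1 g) :
    ∫ x, g x ∂μ - ∫ x, g x ∂ν ≤ ∫ x, ‖x‖ ∂μ + ∫ x, ‖x‖ ∂ν := by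
  obtain ⟨_, hμi⟩ := hμ
  obtain ⟨_, hνi⟩ := hν
  have hle (x : Ed d) : |g x - g 0| ≤ ‖x‖ := by simpa using hg.norm_sub_le x 0
  have h₁ : ∫ x, g x ∂μ ≤ ∫ x, (g 0 + ‖x‖) ∂μ :=
    integral_mono (hg.integrable_of_integrable_norm hμi) ((integrable_const _).add hμi)
      fun x => by linarith [(abs_le.1 (hle x)).2]
  have h₂ : ∫ x, (g 0 - ‖x‖) ∂ν ≤ ∫ x, g x ∂ν :=
    integral_mono ((integrable_const _).sub hνi) (hg.integrable_of_integrable_norm hνi)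
      fun x => by linarith [(abs_le.1 (hle x)).1]
  rw [integral_add (integrable_const _) hμi] at h₁
  rw [integral_sub (integrable_const _) hνi] at h₂
  simp only [integral_const, probReal_univ, one_smul] at h₁ h₂
  linarith

theorem integral_sub_integral_le_W1 {d : ℕ} {μ ν : Measure (Ed d)}
    (hμ : IsP1 μ) (hν : IsP1 ν) {g : Ed d → ℝ} (hg : LipschitzWith 1 g) :
    ∫ x, g x ∂μ - ∫ x, g x ∂ν ≤ W1 μ ν := by
  refine le_ciSup (f := fun f : {f : Ed d → ℝ // LipschitzWith 1 f} =>
    ∫ x, f.1 x ∂μ - ∫ x, f.1 x ∂ν) ⟨∫ x, ‖x‖ ∂μ + ∫ x, ‖x‖ ∂ν, ?_⟩ ⟨g, hg⟩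
  rintro _ ⟨f, rfl⟩
  exact integral_sub_integral_le_of_lipschitzWith_one hμ hν f.2

/-- The easy half of Kantorovich–Rubinstein duality for a Lipschitz test function. -/
theorem abs_integral_sub_integral_le_mul_W1 {d : ℕ} {μ ν : Measure (Ed d)}
    (hμ : IsP1 μ) (hν : IsP1 ν) {K : NNReal} {g : Ed d → ℝ} (hg : LipschitzWith K g) :
    |∫ x, g x ∂μ - ∫ x, g x ∂ν| ≤ K * W1 μ ν := by
  rcases eq_or_ne K 0 with rfl | hK
  · have := hμ.1
    have := hν.1
    have hconst (x : Ed d) : g x = g 0 := by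
      simpa [sub_eq_zero] using hg.norm_sub_le x 0
    simp [hconst]
  · have hscale : LipschitzWith 1 fun x => (K : ℝ)⁻¹ * g x := by
      refine LipschitzWith.of_dist_le_mul fun x y => ?_
      have hK' : (0 : ℝ) < K := by positivity
      rw [Real.dist_eq, ← mul_sub, abs_mul, abs_of_pos (inv_pos.2 hK'), inv_mul_le_iff₀ hK']
      simpa [Real.dist_eq] using hg.dist_le_mul x y
    have hK' : (0 : ℝ) < K := by positivity
    have h₁ := integral_sub_integral_le_W1 hμ hν hscale
    have h₂ := integral_sub_integral_le_W1 hμ hν hscale.neg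
    simp only [Pi.neg_apply, integral_neg, integral_const_mul] at h₁ h₂
    rw [← mul_sub, inv_mul_le_iff₀ hK'] at h₁
    rw [neg_sub_neg, ← mul_sub, inv_mul_le_iff₀ hK'] at h₂
    exact abs_sub_le_iff.2 ⟨h₁, h₂⟩

theorem log_integral_exp_sub_le {A : Type*} [MeasurableSpace A] {η : Measure A} [NeZero η]
    {u v : A → ℝ} {c : ℝ} (hu : Integrable (fun a => Real.exp (u a)) η)
    (hv : Integrable (fun a => Real.exp (v a)) η) (huv : ∀ a, u a - v a ≤ c) :
    Real.log (∫ a, Real.exp (u a) ∂η) - Real.log (∫ a, Real.exp (v a) ∂η) ≤ c := by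
  have hle : ∫ a, Real.exp (u a) ∂η ≤ Real.exp c * ∫ a, Real.exp (v a) ∂η := by
    rw [← integral_const_mul]
    refine integral_mono hu (hv.const_mul _) fun a => ?_
    rw [← Real.exp_add]
    exact Real.exp_le_exp.2 (by linarith [huv a])
  have hlog := Real.log_le_log (integral_exp_pos hu) hle
  rw [Real.log_mul (Real.exp_pos c).ne' (integral_exp_pos hv).ne', Real.log_exp] at hlog
  linarith

theorem integrable_exp_fnu {d : ℕ} {S A : Type*} [MeasurableSpace S] [MeasurableSpace A]
    (η : Measure A) [IsFiniteMeasure η] {f : Ed d → S → A → ℝ}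
    (hf : Measurable (fun p : Ed d × S × A => f p.1 p.2.1 p.2.2)) {C : ℝ}
    (hC : ∀ θ s a, |f θ s a| ≤ C) (ν : Measure (Ed d)) [IsProbabilityMeasure ν] (s : S) :
    Integrable (fun a => Real.exp (fnu f ν s a)) η := by
  have hsec : Measurable (fun p : A × Ed d => f p.2 s p.1) :=
    hf.comp (measurable_snd.prodMk (measurable_const.prodMk measurable_fst))
  have hmeas : Measurable (fun a => fnu f ν s a) :=
    hsec.stronglyMeasurable.integral_prod_right'.measurable
  refine Integrable.of_bound hmeas.exp.aestronglyMeasurable (Real.exp C)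
    (Eventually.of_forall fun a => ?_)
  have hbound : ‖fnu f ν s a‖ ≤ C := by
    simpa [fnu] using norm_integral_le_of_norm_le_const (μ := ν) (f := fun θ => f θ s a)
      (Eventually.of_forall fun θ => (Real.norm_eq_abs _).trans_le (hC θ s a))
  rw [Real.norm_eq_abs, Real.abs_exp]
  exact Real.exp_le_exp.2 ((le_abs_self _).trans hbound)

/-- **Lemma (Lipschitz continuity of the log-density of the softmax policy in the
network parameter measure).** -/
theorem softmax_log_density_lipschitz
    {d : ℕ} {S A : Type*}
    [MeasurableSpace S] [TopologicalSpace S] [PolishSpace S] [BorelSpace S]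
    [MeasurableSpace A] [TopologicalSpace A] [PolishSpace A] [BorelSpace A]
    (η : Measure A) (hηfin : IsFiniteMeasure η) (hη0 : η ≠ 0)
    (f : Ed d → S → A → ℝ)
    (hfmeas : Measurable (fun p : Ed d × S × A => f p.1 p.2.1 p.2.2))
    (nf0 nf1 : ℝ)
    (hf0 : ∀ θ s a, |f θ s a| ≤ nf0)
    (hfdiff : ∀ s a, Differentiable ℝ (fun θ => f θ s a))
    (hf1 : ∀ θ s a, ‖fderiv ℝ (fun θ' => f θ' s a) θ‖ ≤ nf1)
    (hnf : nf0 ≤ nf1) :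
    ∀ ν ν', IsP1 ν → IsP1 ν' → ∀ s a,
      |logSoftmaxDensity f η ν' s a - logSoftmaxDensity f η ν s a| ≤
        2 * nf1 * W1 ν' ν := by
  intro ν ν' hν hν' s a
  have := hν.1
  have := hν'.1
  have : NeZero η := ⟨hη0⟩
  have hnf1 : 0 ≤ nf1 := (norm_nonneg _).trans (hf1 0 s a)
  have hdiff (b : A) : |fnu f ν' s b - fnu f ν s b| ≤ nf1 * W1 ν' ν := by
    have hlip : LipschitzWith ⟨nf1, hnf1⟩ fun θ => f θ s b :=
      lipschitzWith_of_nnnorm_fderiv_le (hfdiff s b) fun θ => hf1 θ s b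
    exact abs_integral_sub_integral_le_mul_W1 hν' hν hlip
  have hint := integrable_exp_fnu η hfmeas hf0 ν s
  have hint' := integrable_exp_fnu η hfmeas hf0 ν' s
  have hlog := log_integral_exp_sub_le hint' hint fun b => (abs_sub_le_iff.1 (hdiff b)).1
  have hlog' := log_integral_exp_sub_le hint hint' fun b => (abs_sub_le_iff.1 (hdiff b)).2
  obtain ⟨h₁, h₂⟩ := abs_sub_le_iff.1 (hdiff a)
  unfold logSoftmaxDensity
  exact abs_sub_le_iff.2 ⟨by linarith, by linarith⟩
end
end
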